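/- arXiv:1810.01499 — 14 statements merged into one kernel-verified Lean document; each statement's English description precedes it below -/
import Mathlib

section
/- Let n ≥ 1 and let a = (a_1,…,a_n), b = (b_1,…,b_n) be positive integer vectors that are fan ordered, i.e., a_i/b_i ≥ a_{i+1}/b_{i+1} for i = 1,…,n−1. Set λ_j = a_j/b_j for j = 1,…,n, and define in ℝ^{n+2}: w_0 = (1, 0, a_1,…,a_n), w_{n+1} = (0, 1, b_1,…,b_n), and for j = 1,…,n, w_j = (1, λ_j, a_1,…,a_j, λ_j b_{j+1},…,λ_j b_n). Then C(a,b) equals the set of all linear combinations with nonnegative real coefficients of the vectors e_3,…,e_{n+2}, w_0, w_1,…,w_n, w_{n+1}; in particular C(a,b) is a convex polyhedral cone. -/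
open Finset

/-- The cone `C(a,b) ⊆ ℝ^(n+2)`. -/
def coneC (n : ℕ) (a b : Fin n → ℕ) : Set (Fin (n + 2) → ℝ) :=
  {x | 0 ≤ x 0 ∧ 0 ≤ x 1 ∧
    ∀ i : Fin n, max ((a i : ℝ) * x 0) ((b i : ℝ) * x 1) ≤ x i.succ.succ}

/-- The vectors `w_0, w_1, …, w_n, w_{n+1}` of the paper, indexed by `j : Fin (n+2)`:
`w_0 = (1,0,a_1,…,a_n)`, `w_{n+1} = (0,1,b_1,…,b_n)`, and for `1 ≤ j ≤ n`,
`w_j = (1, λ_j, a_1,…,a_j, λ_j b_{j+1},…, λ_j b_n)` with `λ_j = a_j / b_j`. -/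
noncomputable def wVec (n : ℕ) (a b : Fin n → ℕ) (j : Fin (n + 2)) : Fin (n + 2) → ℝ :=
  if h0 : (j : ℕ) = 0 then
    Fin.cons 1 (Fin.cons 0 (fun i => (a i : ℝ)))
  else if h1 : (j : ℕ) = n + 1 then
    Fin.cons 0 (Fin.cons 1 (fun i => (b i : ℝ)))
  else
    let jn : Fin n := ⟨(j : ℕ) - 1, by have := j.isLt; omega⟩
    let lam : ℝ := (a jn : ℝ) / (b jn : ℝ)
    Fin.cons 1 (Fin.cons lam
      (fun i => if (i : ℕ) + 1 ≤ (j : ℕ) then (a i : ℝ) else lam * (b i : ℝ)))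

lemma one_ne_succ_succ {n : ℕ} (i : Fin n) : (1 : Fin (n + 2)) ≠ i.succ.succ := by
  simp [Fin.ext_iff]

section Coordinates

variable (n : ℕ) (a b : Fin n → ℕ)

lemma wVec_zero : wVec n a b 0 = Fin.cons 1 (Fin.cons 0 (fun i => (a i : ℝ))) := by
  simp [wVec]

lemma wVec_last :
    wVec n a b (Fin.last (n + 1)) = Fin.cons 0 (Fin.cons 1 (fun i => (b i : ℝ))) := by
  simp [wVec]

lemma wVec_succ (m : Fin n) :
    wVec n a b m.castSucc.succ = Fin.cons 1 (Fin.cons ((a m : ℝ) / b m)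
      (fun i => if i ≤ m then (a i : ℝ) else (a m : ℝ) / b m * b i)) := by
  have hm := m.isLt
  simp [wVec, hm.ne]

variable {n a b}

/-- A vector is a nonnegative combination of the generators if its first two coordinates agree
with those of a nonnegative combination of `w_p` and `w_q` and its other coordinates dominate it. -/
lemma exists_nonneg_combination_of_pair {x : Fin (n + 2) → ℝ} (p q : Fin (n + 2)) {α β : ℝ}
    (hα : 0 ≤ α) (hβ : 0 ≤ β)
    (h0 : x 0 = α * wVec n a b p 0 + β * wVec n a b q 0)
    (h1 : x 1 = α * wVec n a b p 1 + β * wVec n a b q 1)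
    (h : ∀ i : Fin n, α * wVec n a b p i.succ.succ + β * wVec n a b q i.succ.succ
      ≤ x i.succ.succ) :
    ∃ (c : Fin n → ℝ) (d : Fin (n + 2) → ℝ), (∀ i, 0 ≤ c i) ∧ (∀ j, 0 ≤ d j) ∧
      x = (∑ i : Fin n, c i • (Pi.single i.succ.succ 1 : Fin (n + 2) → ℝ))
          + ∑ j : Fin (n + 2), d j • wVec n a b j := by
  refine ⟨fun i => x i.succ.succ -
      (α * wVec n a b p i.succ.succ + β * wVec n a b q i.succ.succ),
    Pi.single p α + Pi.single q β, fun i => sub_nonneg.2 (h i), fun j => ?_, ?_⟩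
  · exact add_nonneg ((Pi.single_nonneg.2 hα : (0 : Fin (n + 2) → ℝ) ≤ _) j)
      ((Pi.single_nonneg.2 hβ : (0 : Fin (n + 2) → ℝ) ≤ _) j)
  · have hd : ∑ j, (Pi.single p α + Pi.single q β : Fin (n + 2) → ℝ) j • wVec n a b j
        = α • wVec n a b p + β • wVec n a b q := by
      simp [add_smul, Finset.sum_add_distrib, Pi.single_apply, ite_smul]
    rw [hd]
    ext k
    refine Fin.cases ?_ (fun k => Fin.cases ?_ (fun k => ?_) k) k
    · simp [h0, Finset.sum_apply, (Fin.succ_ne_zero _).symm]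
    · simp [h1, Finset.sum_apply, one_ne_succ_succ]
    · simp [Finset.sum_apply, Pi.single_apply]

lemma antitone_ratio
    (hfan : ∀ i : Fin n, ∀ hi : (i : ℕ) + 1 < n,
      (a ⟨(i : ℕ) + 1, hi⟩ : ℝ) / (b ⟨(i : ℕ) + 1, hi⟩ : ℝ) ≤ (a i : ℝ) / (b i : ℝ)) :
    Antitone fun i => (a i : ℝ) / b i := by
  rintro ⟨i, hi⟩ ⟨j, hj⟩ hij
  rw [Fin.mk_le_mk] at hij
  induction j, hij using Nat.le_induction with
  | base => rfl
  | succ k hk ih => exact (hfan ⟨k, by omega⟩ hj).trans (ih (by omega))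

lemma wVec_mem_coneC (hb : ∀ i, 0 < b i) (hanti : Antitone fun i => (a i : ℝ) / b i)
    (j : Fin (n + 2)) : wVec n a b j ∈ coneC n a b := by
  have hb' : ∀ i, (0 : ℝ) < b i := fun i => Nat.cast_pos.2 (hb i)
  refine Fin.cases ?_ (fun j => Fin.lastCases ?_ (fun m => ?_) j) j
  · rw [wVec_zero]
    simp only [coneC, Set.mem_ofPred_eq, ← Fin.succ_zero_eq_one, Fin.cons_zero, Fin.cons_succ]
    simp
  · rw [Fin.succ_last, wVec_last]
    simp only [coneC, Set.mem_ofPred_eq, ← Fin.succ_zero_eq_one, Fin.cons_zero, Fin.cons_succ]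
    simp
  · rw [wVec_succ]
    simp only [coneC, Set.mem_ofPred_eq, ← Fin.succ_zero_eq_one, Fin.cons_zero, Fin.cons_succ]
    refine ⟨zero_le_one, by positivity, fun i => ?_⟩
    split_ifs with him
    · have : (a m : ℝ) / b m ≤ a i / b i := hanti him
      rw [le_div_iff₀ (hb' i)] at this
      exact max_le (by simp) (by linarith)
    · have : (a i : ℝ) / b i ≤ a m / b m := hanti (not_le.1 him).le
      rw [div_le_iff₀ (hb' i)] at this
      exact max_le (by linarith) (by linarith)

lemma nonneg_combination_mem_coneC (hb : ∀ i, 0 < b i)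
    (hanti : Antitone fun i => (a i : ℝ) / b i) {c : Fin n → ℝ} {d : Fin (n + 2) → ℝ}
    (hc : ∀ i, 0 ≤ c i) (hd : ∀ j, 0 ≤ d j) :
    (∑ i : Fin n, c i • (Pi.single i.succ.succ 1 : Fin (n + 2) → ℝ))
      + ∑ j : Fin (n + 2), d j • wVec n a b j ∈ coneC n a b := by
  have hw := wVec_mem_coneC hb hanti
  have h0 : ((∑ i : Fin n, c i • (Pi.single i.succ.succ 1 : Fin (n + 2) → ℝ))
      + ∑ j : Fin (n + 2), d j • wVec n a b j) 0 = ∑ j, d j * wVec n a b j 0 := by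
    simp [Finset.sum_apply, (Fin.succ_ne_zero _).symm]
  have h1 : ((∑ i : Fin n, c i • (Pi.single i.succ.succ 1 : Fin (n + 2) → ℝ))
      + ∑ j : Fin (n + 2), d j • wVec n a b j) 1 = ∑ j, d j * wVec n a b j 1 := by
    simp [Finset.sum_apply, one_ne_succ_succ]
  have h2 (i : Fin n) : ((∑ i : Fin n, c i • (Pi.single i.succ.succ 1 : Fin (n + 2) → ℝ))
      + ∑ j : Fin (n + 2), d j • wVec n a b j) i.succ.succ
      = c i + ∑ j, d j * wVec n a b j i.succ.succ := by
    simp [Finset.sum_apply, Pi.single_apply]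
  refine ⟨?_, ?_, fun i => ?_⟩
  · rw [h0]
    exact Finset.sum_nonneg fun j _ => mul_nonneg (hd j) (hw j).1
  · rw [h1]
    exact Finset.sum_nonneg fun j _ => mul_nonneg (hd j) (hw j).2.1
  · rw [h0, h1, h2, Finset.mul_sum, Finset.mul_sum]
    refine (max_le ?_ ?_).trans (le_add_of_nonneg_left (hc i)) <;>
      refine Finset.sum_le_sum fun j _ => ?_ <;> rw [mul_left_comm] <;>
      refine mul_le_mul_of_nonneg_left ?_ (hd j)
    · exact (le_max_left _ _).trans ((hw j).2.2 i)
    · exact (le_max_right _ _).trans ((hw j).2.2 i)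

lemma exists_nonneg_combination_of_mem_coneC (hn : 1 ≤ n) (ha : ∀ i, 0 < a i)
    (hb : ∀ i, 0 < b i) {x : Fin (n + 2) → ℝ}
    (hx : x ∈ coneC n a b) :
    ∃ (c : Fin n → ℝ) (d : Fin (n + 2) → ℝ), (∀ i, 0 ≤ c i) ∧ (∀ j, 0 ≤ d j) ∧
      x = (∑ i : Fin n, c i • (Pi.single i.succ.succ 1 : Fin (n + 2) → ℝ))
          + ∑ j : Fin (n + 2), d j • wVec n a b j := by
  obtain ⟨hr, hs, ht⟩ := hx
  have hta (i) : (a i : ℝ) * x 0 ≤ x i.succ.succ := (le_max_left _ _).trans (ht i)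
  have htb (i) : (b i : ℝ) * x 1 ≤ x i.succ.succ := (le_max_right _ _).trans (ht i)
  have ha' : ∀ i, (0 : ℝ) < a i := fun i => Nat.cast_pos.2 (ha i)
  have hb' : ∀ i, (0 : ℝ) < b i := fun i => Nat.cast_pos.2 (hb i)
  by_cases hlast : x 1 ≤ (a ⟨n - 1, by omega⟩ : ℝ) / b ⟨n - 1, by omega⟩ * x 0
  · set m : Fin n := ⟨n - 1, by omega⟩
    have hl : (0 : ℝ) < a m / b m := div_pos (ha' m) (hb' m)
    have hle (i : Fin n) : i ≤ m := Fin.mk_le_mk.2 (by omega)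
    have hsl : x 1 / (a m / b m) ≤ x 0 := (div_le_iff₀' hl).2 hlast
    refine exists_nonneg_combination_of_pair 0 m.castSucc.succ
      (sub_nonneg.2 hsl) (div_nonneg hs hl.le) ?_ ?_ fun i => ?_ <;>
      rw [wVec_zero, wVec_succ] <;>
      simp only [← Fin.succ_zero_eq_one, Fin.cons_zero, Fin.cons_succ]
    · ring
    · rw [div_mul_cancel₀ _ hl.ne']
      ring
    · rw [if_pos (hle i)]
      linarith [hta i]
  have hex : ∃ k : ℕ, ∃ hk : k < n, (a ⟨k, hk⟩ : ℝ) / b ⟨k, hk⟩ * x 0 < x 1 :=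
    ⟨n - 1, by omega, not_le.1 hlast⟩
  classical
  obtain ⟨hk, hkx⟩ := Nat.find_spec hex
  have hmin := fun m => Nat.find_min hex (m := m)
  generalize Nat.find hex = k at hk hkx hmin
  obtain _ | k := k
  · set m : Fin n := ⟨0, hk⟩
    refine exists_nonneg_combination_of_pair m.castSucc.succ (Fin.last (n + 1))
      hr (sub_nonneg.2 hkx.le) ?_ ?_ fun i => ?_ <;>
      rw [wVec_last, wVec_succ] <;>
      simp only [← Fin.succ_zero_eq_one, Fin.cons_zero, Fin.cons_succ]
    · ring
    · rw [Fin.succ_zero_eq_one]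
      ring
    · have hi := htb i
      split_ifs with him
      · obtain rfl : i = m := le_antisymm him (Fin.mk_le_mk.2 (Nat.zero_le _))
        have : (a m : ℝ) / b m * b m = a m := div_mul_cancel₀ _ (hb' m).ne'
        rw [Fin.succ_zero_eq_one]
        linear_combination hi - x 0 * this
      · rw [Fin.succ_zero_eq_one]
        linear_combination hi
  · set m : Fin n := ⟨k + 1, hk⟩
    set l : Fin n := ⟨k, by omega⟩
    have hlx : x 1 ≤ (a l : ℝ) / b l * x 0 := by
      by_contra! h
      exact hmin k (by omega) ⟨_, h⟩
    have hml : (a m : ℝ) / b m < a l / b l :=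
      lt_of_mul_lt_mul_right (hkx.trans_le hlx) hr
    set u : ℝ := a l / b l with hu
    set v : ℝ := a m / b m with hv
    have huv : 0 < u - v := sub_pos.2 hml
    have hsum : (x 1 - v * x 0) / (u - v) + (u * x 0 - x 1) / (u - v) = x 0 := by
      field_simp
      ring
    have hcomb : (x 1 - v * x 0) / (u - v) * u + (u * x 0 - x 1) / (u - v) * v = x 1 := by
      field_simp
      ring
    refine exists_nonneg_combination_of_pair l.castSucc.succ m.castSucc.succ
      (div_nonneg (sub_nonneg.2 hkx.le) huv.le) (div_nonneg (sub_nonneg.2 hlx) huv.le)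
      ?_ ?_ fun i => ?_ <;>
      rw [wVec_succ, wVec_succ, ← hu, ← hv] <;>
      simp only [← Fin.succ_zero_eq_one, Fin.cons_zero, Fin.cons_succ] <;>
      rw [Fin.succ_zero_eq_one] <;>
      generalize (x 1 - v * x 0) / (u - v) = α at * <;>
      generalize (u * x 0 - x 1) / (u - v) = β at *
    · linarith
    · linarith
    · have hia := hta i
      have hib := htb i
      by_cases hil : i ≤ l
      · have him : i ≤ m := hil.trans (Fin.mk_le_mk.2 (Nat.le_succ k))
        rw [if_pos hil, if_pos him]
        linear_combination hia + a i * hsum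
      · rw [if_neg hil]
        split_ifs with him
        · obtain rfl : i = m := le_antisymm him (Nat.succ_le_of_lt (not_le.1 hil))
          have : v * b m = a m := div_mul_cancel₀ _ (hb' m).ne'
          linear_combination hib + b m * hcomb - β * this
        · linear_combination hib + b i * hcomb

end Coordinates

/-- if `a, b` are positive fan-ordered integer vectors, then `C(a,b)` is exactly
the set of nonnegative real linear combinations of `e_3, …, e_{n+2}, w_0, w_1, …, w_{n+1}`;
in particular it is a convex polyhedral cone. -/
theorem coneC_eq_nonneg_combinations (n : ℕ) (hn : 1 ≤ n) (a b : Fin n → ℕ)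
    (ha : ∀ i, 0 < a i) (hb : ∀ i, 0 < b i)
    (hfan : ∀ i : Fin n, ∀ hi : (i : ℕ) + 1 < n,
      (a ⟨(i : ℕ) + 1, hi⟩ : ℝ) / (b ⟨(i : ℕ) + 1, hi⟩ : ℝ) ≤ (a i : ℝ) / (b i : ℝ)) :
    coneC n a b =
      {x | ∃ (c : Fin n → ℝ) (d : Fin (n + 2) → ℝ),
        (∀ i, 0 ≤ c i) ∧ (∀ j, 0 ≤ d j) ∧
        x = (∑ i : Fin n, c i • (Pi.single i.succ.succ 1 : Fin (n + 2) → ℝ))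
            + ∑ j : Fin (n + 2), d j • wVec n a b j} := by
  have hanti := antitone_ratio hfan
  ext x
  constructor
  · exact exists_nonneg_combination_of_mem_coneC hn ha hb
  · rintro ⟨c, d, hc, hd, rfl⟩
    exact nonneg_combination_mem_coneC hb hanti hc hd
end

section
/- Let n ≥ 1 and let a = (a_1,…,a_n), b = (b_1,…,b_n) be positive integer vectors that are fan ordered, i.e., a_i/b_i ≥ a_{i+1}/b_{i+1} for i = 1,…,n−1. Then the cone σ generated by {e_1, e_2, α_1,…,α_n, β_1,…,β_n} in ℝ^{n+2} and the cone C(a,b) are dual to each other: C(a,b) = {u ∈ ℝ^{n+2} : ⟨m, u⟩ ≥ 0 for every m ∈ σ}, and equivalently {m ∈ ℝ^{n+2} : ⟨m, u⟩ ≥ 0 for all u ∈ C(a,b)} equals the set of nonnegative real linear combinations of e_1, e_2, α_1,…,α_n, β_1,…,β_n. -/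
open Finset

/-- The standard inner product on `ℝ^(n+2)`. -/
def dotR (n : ℕ) (u v : Fin (n + 2) → ℝ) : ℝ := ∑ j : Fin (n + 2), u j * v j

/-- `α_i = -a_i e_1 + e_{i+2}` in `ℝ^(n+2)`. -/
def alphaVec (n : ℕ) (a : Fin n → ℕ) (i : Fin n) : Fin (n + 2) → ℝ :=
  (-(a i : ℝ)) • (Pi.single 0 1 : Fin (n + 2) → ℝ)
    + (Pi.single i.succ.succ 1 : Fin (n + 2) → ℝ)

/-- `β_i = -b_i e_2 + e_{i+2}` in `ℝ^(n+2)`. -/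
def betaVec (n : ℕ) (b : Fin n → ℕ) (i : Fin n) : Fin (n + 2) → ℝ :=
  (-(b i : ℝ)) • (Pi.single 1 1 : Fin (n + 2) → ℝ)
    + (Pi.single i.succ.succ 1 : Fin (n + 2) → ℝ)

/-- The cone `σ` generated by `e_1, e_2, α_1, …, α_n, β_1, …, β_n`: the set of nonnegative
real linear combinations of these `2n+2` vectors. -/
def sigmaCone (n : ℕ) (a b : Fin n → ℕ) : Set (Fin (n + 2) → ℝ) :=
  {m | ∃ (c₁ c₂ : ℝ) (d e : Fin n → ℝ),
    0 ≤ c₁ ∧ 0 ≤ c₂ ∧ (∀ i, 0 ≤ d i) ∧ (∀ i, 0 ≤ e i) ∧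
    m = c₁ • (Pi.single 0 1 : Fin (n + 2) → ℝ) + c₂ • (Pi.single 1 1 : Fin (n + 2) → ℝ)
        + ∑ i : Fin n, d i • alphaVec n a i + ∑ i : Fin n, e i • betaVec n b i}

theorem dotR_eq (n : ℕ) (u v : Fin (n + 2) → ℝ) :
    dotR n u v = u 0 * v 0 + u 1 * v 1 + ∑ i : Fin n, u i.succ.succ * v i.succ.succ := by
  simp [dotR, Fin.sum_univ_succ, add_assoc]

theorem mem_sigmaCone_iff {n : ℕ} {a b : Fin n → ℕ} {m : Fin (n + 2) → ℝ} :
    m ∈ sigmaCone n a b ↔ ∃ d e : Fin n → ℝ, (∀ i, 0 ≤ d i) ∧ (∀ i, 0 ≤ e i) ∧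
      0 ≤ m 0 + ∑ i, d i * a i ∧ 0 ≤ m 1 + ∑ i, e i * b i ∧
      ∀ i : Fin n, m i.succ.succ = d i + e i := by
  have key : ∀ (c₁ c₂ : ℝ) (d e : Fin n → ℝ),
      m = c₁ • (Pi.single 0 1 : Fin (n + 2) → ℝ) + c₂ • (Pi.single 1 1 : Fin (n + 2) → ℝ)
        + ∑ i : Fin n, d i • alphaVec n a i + ∑ i : Fin n, e i • betaVec n b i ↔
      m 0 = c₁ - ∑ i, d i * a i ∧ m 1 = c₂ - ∑ i, e i * b i ∧
        ∀ i : Fin n, m i.succ.succ = d i + e i := by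
    intro c₁ c₂ d e
    have h1 : ∀ i : Fin n, i.succ.succ ≠ (1 : Fin (n + 2)) := fun i h =>
      Fin.succ_ne_zero i (Fin.succ_injective _ h)
    rw [funext_iff, Fin.forall_fin_succ, Fin.forall_fin_succ]
    simp [alphaVec, betaVec, Pi.single_apply, h1, fun i => (h1 i).symm,
      (Fin.succ_ne_zero _).symm, sub_eq_add_neg]
  constructor
  · rintro ⟨c₁, c₂, d, e, h₁, h₂, hd, he, h⟩
    obtain ⟨h0, h1, hi⟩ := (key c₁ c₂ d e).1 h
    exact ⟨d, e, hd, he, by linarith, by linarith, hi⟩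
  · rintro ⟨d, e, hd, he, h₁, h₂, hi⟩
    exact ⟨_, _, d, e, h₁, h₂, hd, he, (key _ _ d e).2 ⟨by ring, by ring, hi⟩⟩

/-- If `p r + q s + ∑ wᵢ max(aᵢ r, bᵢ s)` is nonnegative on the quadrant, then the weights `w`
can be split so that both resulting linear coefficients are nonnegative. -/
theorem exists_split_of_forall_max_nonneg {ι : Type*} [Fintype ι] (a b w : ι → ℝ) (p q : ℝ)
    (hw : ∀ i, 0 ≤ w i)
    (h : ∀ r s : ℝ, 0 ≤ r → 0 ≤ s → 0 ≤ p * r + q * s + ∑ i, w i * max (a i * r) (b i * s)) :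
    ∃ d : ι → ℝ, (∀ i, 0 ≤ d i) ∧ (∀ i, d i ≤ w i) ∧
      0 ≤ p + ∑ i, d i * a i ∧ 0 ≤ q + ∑ i, (w i - d i) * b i := by
  classical
  let L : (ι → ℝ) →ₗ[ℝ] ℝ × ℝ :=
    (∑ i, a i • LinearMap.proj i).prod (-∑ i, b i • LinearMap.proj i)
  have hL : ∀ d, L d = (∑ i, d i * a i, -∑ i, d i * b i) := by
    intro d
    simp [L, mul_comm]
  let z : ℝ × ℝ := (-p, -q - ∑ i, w i * b i)
  by_cases hdisj : Disjoint (L '' Set.Icc 0 w) (Set.Ici z)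
  · exfalso
    obtain ⟨f, u, v, hu, huv, hv⟩ := geometric_hahn_banach_compact_closed
      ((convex_Icc 0 w).linear_image L)
      (isCompact_Icc.image L.continuous_of_finiteDimensional) (convex_Ici z) isClosed_Ici hdisj
    have hf : ∀ x y : ℝ, f (x, y) = x * f (1, 0) + y * f (0, 1) := by
      intro x y
      have : (x, y) = x • ((1, 0) : ℝ × ℝ) + y • ((0, 1) : ℝ × ℝ) := by simp
      rw [this, map_add, map_smul, map_smul, smul_eq_mul, smul_eq_mul]
    have hnonneg : ∀ g : ℝ × ℝ, 0 ≤ g → 0 ≤ f g := by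
      intro g hg
      by_contra! hneg
      have hz := hv z Set.self_mem_Ici
      have ht : 0 ≤ (f z - v) / (-f g) := div_nonneg (by linarith) (by linarith)
      have := hv (z + ((f z - v) / (-f g)) • g) (by
        simpa using smul_nonneg ht hg)
      rw [map_add, map_smul, smul_eq_mul] at this
      have he : (f z - v) / (-f g) * f g = -(f z - v) := by
        rw [div_neg, neg_mul, div_mul_cancel₀ _ hneg.ne]
      linarith
    have hr := hnonneg (1, 0) (by constructor <;> simp)
    have hs := hnonneg (0, 1) (by constructor <;> simp)
    have hmax := h _ _ hr hs
    set r := f (1, 0)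
    set s := f (0, 1)
    let d : ι → ℝ := fun i => if b i * s ≤ a i * r then w i else 0
    have hd : d ∈ Set.Icc 0 w := by
      constructor <;> intro i <;> simp only [d] <;> split_ifs <;> simp [hw i]
    have h₁ := hu _ (Set.mem_image_of_mem L hd)
    have h₂ := hv z Set.self_mem_Ici
    rw [hL, hf] at h₁
    rw [hf] at h₂
    have hsum : ∑ i, w i * max (a i * r) (b i * s) =
        (∑ i, d i * a i) * r + (-∑ i, d i * b i) * s + (∑ i, w i * b i) * s := by
      simp only [neg_mul, Finset.sum_mul, ← Finset.sum_neg_distrib, ← Finset.sum_add_distrib]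
      refine Finset.sum_congr rfl fun i _ => ?_
      by_cases hi : b i * s ≤ a i * r
      · simp only [d, hi, if_true, max_eq_left]; ring
      · simp only [d, hi, if_false, max_eq_right (not_le.1 hi).le]; ring
    linarith
  · obtain ⟨_, ⟨d, hd, rfl⟩, hz⟩ := Set.not_disjoint_iff.1 hdisj
    rw [hL] at hz
    obtain ⟨h₁, h₂⟩ := hz
    simp only [z] at h₁ h₂
    refine ⟨d, hd.1, hd.2, by linarith, ?_⟩
    simp only [sub_mul, Finset.sum_sub_distrib]
    linarith

theorem dotR_nonneg {n : ℕ} {a b : Fin n → ℕ} {m u : Fin (n + 2) → ℝ}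
    (hm : m ∈ sigmaCone n a b) (hu : u ∈ coneC n a b) : 0 ≤ dotR n m u := by
  obtain ⟨d, e, hd, he, h₁, h₂, hi⟩ := mem_sigmaCone_iff.1 hm
  obtain ⟨h0, h1, hmax⟩ := hu
  have hsum : (∑ i, d i * a i) * u 0 + (∑ i, e i * b i) * u 1 ≤
      ∑ i : Fin n, m i.succ.succ * u i.succ.succ := by
    rw [Finset.sum_mul, Finset.sum_mul, ← Finset.sum_add_distrib]
    refine Finset.sum_le_sum fun i _ => ?_
    have := mul_le_mul_of_nonneg_left ((le_max_left _ _).trans (hmax i)) (hd i)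
    have := mul_le_mul_of_nonneg_left ((le_max_right _ _).trans (hmax i)) (he i)
    rw [hi]
    linarith
  rw [dotR_eq]
  linarith [mul_nonneg h₁ h0, mul_nonneg h₂ h1]

theorem mem_coneC_of_forall_dotR_nonneg {n : ℕ} {a b : Fin n → ℕ} {u : Fin (n + 2) → ℝ}
    (h : ∀ m ∈ sigmaCone n a b, 0 ≤ dotR n m u) : u ∈ coneC n a b := by
  have test : ∀ (x y : ℝ) (d e : Fin n → ℝ), (∀ i, 0 ≤ d i) → (∀ i, 0 ≤ e i) →
      0 ≤ x + ∑ i, d i * a i → 0 ≤ y + ∑ i, e i * b i →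
      0 ≤ x * u 0 + y * u 1 + ∑ i : Fin n, (d i + e i) * u i.succ.succ := by
    intro x y d e hd he hx hy
    have := h (Fin.cons x (Fin.cons y fun i => d i + e i))
      (mem_sigmaCone_iff.2 ⟨d, e, hd, he, hx, hy, fun _ => rfl⟩)
    rwa [dotR_eq] at this
  have hs : ∀ i j : Fin n, (0 : ℝ) ≤ (Pi.single i 1 : Fin n → ℝ) j := by
    intro i j
    rw [Pi.single_apply]
    split_ifs <;> simp
  refine ⟨?_, ?_, fun i => max_le ?_ ?_⟩
  · simpa using test 1 0 0 0 (by simp) (by simp) (by simp) (by simp)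
  · simpa using test 0 1 0 0 (by simp) (by simp) (by simp) (by simp)
  · have := test (-a i) 0 (Pi.single i 1) 0 (hs i) (by simp) (by simp [Pi.single_apply]) (by simp)
    simp [Pi.single_apply] at this
    linarith
  · have := test 0 (-b i) 0 (Pi.single i 1) (by simp) (hs i) (by simp) (by simp [Pi.single_apply])
    simp [Pi.single_apply] at this
    linarith

theorem mem_sigmaCone_of_forall_dotR_nonneg {n : ℕ} {a b : Fin n → ℕ} {m : Fin (n + 2) → ℝ}
    (h : ∀ u ∈ coneC n a b, 0 ≤ dotR n m u) : m ∈ sigmaCone n a b := by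
  have test : ∀ (r s : ℝ) (t : Fin n → ℝ), 0 ≤ r → 0 ≤ s →
      (∀ i, max (a i * r) (b i * s) ≤ t i) →
      0 ≤ m 0 * r + m 1 * s + ∑ i : Fin n, m i.succ.succ * t i := by
    intro r s t hr hs ht
    have := h (Fin.cons r (Fin.cons s t)) ⟨hr, hs, ht⟩
    rwa [dotR_eq] at this
  have hw : ∀ i : Fin n, 0 ≤ m i.succ.succ := by
    intro i
    have := test 0 0 (Pi.single i 1) le_rfl le_rfl (by
      intro j
      rw [Pi.single_apply]
      split_ifs <;> simp)
    simpa [Pi.single_apply] using this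
  obtain ⟨d, hd, hdw, h₁, h₂⟩ := exists_split_of_forall_max_nonneg
    (fun i => (a i : ℝ)) (fun i => (b i : ℝ)) (fun i => m i.succ.succ) (m 0) (m 1) hw
    fun r s hr hs => test r s _ hr hs fun _ => le_rfl
  exact mem_sigmaCone_iff.2 ⟨d, fun i => m i.succ.succ - d i, hd,
    fun i => sub_nonneg.2 (hdw i), h₁, h₂, fun i => by ring⟩

/-- for positive fan-ordered vectors `a, b`, the cones `σ` and `C(a,b)` are dual
to each other: `C(a,b) = {u : ⟨m,u⟩ ≥ 0 for all m ∈ σ}` and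
`{m : ⟨m,u⟩ ≥ 0 for all u ∈ C(a,b)} = σ`. -/
theorem coneC_sigma_dual (n : ℕ) (hn : 1 ≤ n) (a b : Fin n → ℕ)
    (ha : ∀ i, 0 < a i) (hb : ∀ i, 0 < b i)
    (hfan : ∀ i : Fin n, ∀ hi : (i : ℕ) + 1 < n,
      (a ⟨(i : ℕ) + 1, hi⟩ : ℝ) / (b ⟨(i : ℕ) + 1, hi⟩ : ℝ) ≤ (a i : ℝ) / (b i : ℝ)) :
    coneC n a b = {u | ∀ m ∈ sigmaCone n a b, 0 ≤ dotR n m u} ∧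
    {m | ∀ u ∈ coneC n a b, 0 ≤ dotR n m u} = sigmaCone n a b := by
  exact ⟨Set.Subset.antisymm (fun _ hu _ hm => dotR_nonneg hm hu)
      fun _ hu => mem_coneC_of_forall_dotR_nonneg hu,
    Set.Subset.antisymm (fun _ hm => mem_sigmaCone_of_forall_dotR_nonneg hm)
      fun _ hm _ hu => dotR_nonneg hm hu⟩
end

section
/- Let n ≥ 1 and let a = (a_1,…,a_n), b = (b_1,…,b_n) be integer vectors with nonnegative entries such that for every index i, a_i = 0 or b_i = 0. Then the monoid Q(a,b) is isomorphic, as an additive monoid, to ℕ^{n+2} (so the associated intersection algebra is a polynomial ring in n+2 variables). -/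
/-- The affine monoid `Q(a,b) ⊆ ℕ^(n+2)`:
`Q(a,b) = {(r,s,t_1,…,t_n) : t_i ≥ max(a_i r, b_i s) for all i}`. -/
def Qmon (n : ℕ) (a b : Fin n → ℕ) : AddSubmonoid (Fin (n + 2) → ℕ) where
  carrier := {x | ∀ i : Fin n, max (a i * x 0) (b i * x 1) ≤ x i.succ.succ}
  zero_mem' := by intro i; simp
  add_mem' := by
    intro x y hx hy i
    have h1 := hx i
    have h2 := hy i
    simp only [Pi.add_apply]
    have : max (a i * (x 0 + y 0)) (b i * (x 1 + y 1)) ≤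
        max (a i * x 0) (b i * x 1) + max (a i * y 0) (b i * y 1) := by
      apply max_le
      · rw [Nat.mul_add]
        exact Nat.add_le_add (le_max_left _ _) (le_max_left _ _)
      · rw [Nat.mul_add]
        exact Nat.add_le_add (le_max_right _ _) (le_max_right _ _)
    exact le_trans this (Nat.add_le_add h1 h2)

theorem mem_Qmon_iff_of_disjoint_supports {n : ℕ} {a b : Fin n → ℕ}
    (h : ∀ i : Fin n, a i = 0 ∨ b i = 0) {x : Fin (n + 2) → ℕ} :
    x ∈ Qmon n a b ↔ ∀ i : Fin n, a i * x 0 + b i * x 1 ≤ x i.succ.succ := by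
  refine forall_congr' fun i => ?_
  rcases h i with hi | hi <;> simp [hi]

/-- if for every index `i` one of `a_i`, `b_i` vanishes, then `Q(a,b)` is
isomorphic as an additive monoid to `ℕ^(n+2)` (so the intersection algebra is a polynomial
ring in `n+2` variables). -/
theorem Qmon_iso_of_disjoint_supports (n : ℕ) (hn : 1 ≤ n) (a b : Fin n → ℕ)
    (h : ∀ i : Fin n, a i = 0 ∨ b i = 0) :
    Nonempty (Qmon n a b ≃+ (Fin (n + 2) → ℕ)) := by
  have mem {x} := mem_Qmon_iff_of_disjoint_supports (x := x) h
  refine ⟨AddEquiv.symm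
    { toFun := fun y => ⟨Fin.cons (y 0) (Fin.cons (y 1)
        fun i => y i.succ.succ + (a i * y 0 + b i * y 1)), mem.2 fun i => ?_⟩
      invFun := fun x => Fin.cons (x.1 0) (Fin.cons (x.1 1)
        fun i => x.1 i.succ.succ - (a i * x.1 0 + b i * x.1 1))
      left_inv := fun y => ?_
      right_inv := fun x => Subtype.ext ?_
      map_add' := fun y z => Subtype.ext ?_ }⟩
  · simp
  · funext j
    refine Fin.cases ?_ (fun j => Fin.cases ?_ (fun i => ?_) j) j <;>
      simp
  · funext j
    refine Fin.cases ?_ (fun j => Fin.cases ?_ (fun i => ?_) j) j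
    · simp
    · simp
    · simpa using Nat.sub_add_cancel (mem.1 x.2 i)
  · funext j
    refine Fin.cases ?_ (fun j => Fin.cases ?_ (fun i => ?_) j) j
    · simp
    · simp
    · simp only [AddSubmonoid.coe_add, Pi.add_apply, Fin.cons_succ]
      ring
end

section
/- Let n ≥ 1 and let a = (a_1,…,a_n), b = (b_1,…,b_n) be integer vectors with nonnegative entries. Let S = {i : a_i ≠ 0 and b_i ≠ 0}, let m = |S|, and let a|_S, b|_S ∈ ℕ^m denote the restrictions of a, b to the indices in S. Then there is an additive monoid isomorphism Q(a,b) ≅ Q(a|_S, b|_S) × ℕ^{n−m}. (This realizes the reduction of the intersection algebra B(a,b) to the case of vectors with all entries positive, up to adjoining polynomial variables.) -/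
theorem mem_Qmon_iff {n : ℕ} {a b : Fin n → ℕ} {x : Fin (n + 2) → ℕ} :
    x ∈ Qmon n a b ↔ ∀ i : Fin n, max (a i * x 0) (b i * x 1) ≤ x i.succ.succ :=
  Iff.rfl

theorem Nat.max_mul_mul_eq_add {p q : ℕ} (h : p = 0 ∨ q = 0) (r s : ℕ) :
    max (p * r) (q * s) = p * r + q * s := by
  rcases h with rfl | rfl <;> simp

/-- Coordinates `i` with `a i = 0` or `b i = 0` split off from `Qmon n a b` as free summands:
there the constraint reads `a i * r + b i * s ≤ t i`, so `t i` may be replaced by the slack. -/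
def qmonEquivProd {n m k : ℕ} (a b : Fin n → ℕ) (S : Finset (Fin n))
    (e : Fin m ≃ S) (f : Fin k ≃ (Sᶜ : Finset (Fin n)))
    (hS : ∀ i ∉ S, a i = 0 ∨ b i = 0) :
    Qmon n a b ≃+ Qmon m (fun j => a (e j)) (fun j => b (e j)) × (Fin k → ℕ) :=
  AddEquiv.symm
    { toFun := fun p =>
        ⟨Fin.cons (p.1.1 0) (Fin.cons (p.1.1 1) fun i =>
            if h : i ∈ S then p.1.1 (e.symm ⟨i, h⟩).succ.succ
            else p.2 (f.symm ⟨i, Finset.mem_compl.2 h⟩) + (a i * p.1.1 0 + b i * p.1.1 1)), by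
          refine mem_Qmon_iff.2 fun i => ?_
          simp only [Fin.cons_zero, Fin.cons_one, Fin.cons_succ]
          split_ifs with h
          · simpa using mem_Qmon_iff.1 p.1.2 (e.symm ⟨i, h⟩)
          · rw [Nat.max_mul_mul_eq_add (hS i h)]
            exact Nat.le_add_left _ _⟩
      invFun := fun x =>
        (⟨Fin.cons (x.1 0) (Fin.cons (x.1 1) fun j => x.1 (e j : Fin n).succ.succ),
          fun j => x.2 (e j)⟩,
        fun l => x.1 (f l : Fin n).succ.succ - (a (f l) * x.1 0 + b (f l) * x.1 1))
      left_inv := by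
        rintro ⟨y, z⟩
        refine Prod.ext (Subtype.ext (funext fun j => ?_)) (funext fun l => ?_)
        · refine Fin.cases ?_ (fun j => Fin.cases ?_ (fun j => ?_) j) j <;> simp
        · simp [Finset.mem_compl.1 (f l).2]
      right_inv := by
        intro x
        refine Subtype.ext (funext fun i => ?_)
        refine Fin.cases ?_ (fun i => Fin.cases ?_ (fun i => ?_) i) i
        · simp
        · simp
        · by_cases h : i ∈ S
          · simp [h]
          · have hx := mem_Qmon_iff.1 x.2 i
            rw [Nat.max_mul_mul_eq_add (hS i h)] at hx
            simpa [h] using Nat.sub_add_cancel hx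
      map_add' := by
        intro p q
        refine Subtype.ext (funext fun i => ?_)
        refine Fin.cases ?_ (fun i => Fin.cases ?_ (fun i => ?_) i) i
        · simp
        · simp
        · by_cases h : i ∈ S
          · simp [h]
          · simp [h]
            ring }

/-- with `S = {i : a_i ≠ 0 and b_i ≠ 0}`, `m = |S|`, and `a|_S, b|_S` the
restrictions of `a, b` to `S` (via the order-preserving enumeration of `S`), one has an
additive monoid isomorphism `Q(a,b) ≅ Q(a|_S, b|_S) × ℕ^(n-m)`. -/
theorem Qmon_iso_restriction (n : ℕ) (hn : 1 ≤ n) (a b : Fin n → ℕ)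
    (S : Finset (Fin n)) (hS : S = Finset.univ.filter (fun i : Fin n => a i ≠ 0 ∧ b i ≠ 0))
    (m : ℕ) (hm : S.card = m) (aS bS : Fin m → ℕ)
    (haS : ∀ j : Fin m, aS j = a (S.orderIsoOfFin hm j))
    (hbS : ∀ j : Fin m, bS j = b (S.orderIsoOfFin hm j)) :
    Nonempty (Qmon n a b ≃+ (Qmon m aS bS × (Fin (n - m) → ℕ))) := by
  have hSc : Sᶜ.card = n - m := by simp [Finset.card_compl, hm]
  obtain rfl := funext haS
  obtain rfl := funext hbS
  refine ⟨qmonEquivProd a b S (S.orderIsoOfFin hm).toEquiv (Sᶜ.orderIsoOfFin hSc).toEquiv ?_⟩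
  intro i hi
  simp only [hS, Finset.mem_filter, Finset.mem_univ, true_and] at hi
  tauto
end

section
/- Let k be a field, n ≥ 1, and let a = (a_1,…,a_n), b = (b_1,…,b_n) be positive integer vectors. Then the monoid algebra k[Q(a,b)] (the k-algebra with k-basis the monomials indexed by Q(a,b), multiplication induced by addition in Q(a,b)) is an integrally closed integral domain whose Krull dimension equals n + 2. -/
open Polynomial LaurentPolynomial in
/-- If `R[X]` is integrally closed, it is integrally closed in `R[X, X⁻¹]`. -/
theorem LaurentPolynomial.exists_toLaurent_eq_of_isIntegralElem {R : Type*} [CommRing R]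
    [IsDomain R] [IsIntegrallyClosed R[X]] {f : R[T;T⁻¹]}
    (hf : (toLaurent : R[X] →+* R[T;T⁻¹]).IsIntegralElem f) : ∃ p : R[X], toLaurent p = f := by
  have hu : ∀ y : Submonoid.powers (X : R[X]), IsUnit (algebraMap R[X] (FractionRing R[X]) y) := by
    rintro ⟨_, m, rfl⟩
    simp
  have hinj : Function.Injective (IsLocalization.lift (S := R[T;T⁻¹]) hu) := by
    rw [IsLocalization.lift_injective_iff]
    intro x y
    rw [(IsFractionRing.injective R[X] (FractionRing R[X])).eq_iff]
    exact Polynomial.toLaurent_inj x y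
  have hcomp (p : R[X]) : IsLocalization.lift (S := R[T;T⁻¹]) hu (toLaurent p) =
      algebraMap R[X] (FractionRing R[X]) p := IsLocalization.lift_eq hu p
  obtain ⟨P, hP, h0⟩ := hf
  have hint : IsIntegral R[X] (IsLocalization.lift (S := R[T;T⁻¹]) hu f) := by
    refine ⟨P, hP, ?_⟩
    have := congrArg (IsLocalization.lift (S := R[T;T⁻¹]) hu) h0
    rw [hom_eval₂, map_zero] at this
    have hring : (IsLocalization.lift (S := R[T;T⁻¹]) hu).comp toLaurent =
        algebraMap R[X] (FractionRing R[X]) := RingHom.ext hcomp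
    rwa [hring] at this
  obtain ⟨p, hp⟩ := IsIntegrallyClosed.isIntegral_iff.mp hint
  exact ⟨p, hinj (by rw [hcomp, hp])⟩

namespace AddMonoidAlgebra

variable {k M N : Type*} [Field k] [AddCommMonoid M] [AddCommMonoid N]

variable (k) in
/-- The algebra map sending the monomial `v` to `v * T ^ l v`. -/
noncomputable def toLaurentOfHom (l : N →+ ℤ) :
    AddMonoidAlgebra k N →ₐ[k] LaurentPolynomial (AddMonoidAlgebra k N) :=
  AddMonoidAlgebra.lift k (LaurentPolynomial (AddMonoidAlgebra k N)) N
    { toFun v := .single (l v.toAdd) (single v.toAdd 1)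
      map_one' := by simp [one_def, -LaurentPolynomial.single_eq_C_mul_T]
      map_mul' v w := by
        simp [single_mul_single, -LaurentPolynomial.single_eq_C_mul_T] }

theorem toLaurentOfHom_single (l : N →+ ℤ) (v : N) (c : k) :
    toLaurentOfHom k l (single v c) = .single (l v) (single v c) := by
  simp [toLaurentOfHom, lift_single, -LaurentPolynomial.single_eq_C_mul_T]

theorem coeff_toLaurentOfHom (l : N →+ ℤ) (f : AddMonoidAlgebra k N) (v : N) :
    ((toLaurentOfHom k l f).coeff (l v)).coeff v = f.coeff v := by
  classical
  induction f using AddMonoidAlgebra.induction_linear with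
  | zero => simp
  | add f g hf hg => simp [hf, hg]
  | single w c =>
    rw [toLaurentOfHom_single]
    by_cases h : w = v
    · simp [h, -LaurentPolynomial.single_eq_C_mul_T]
    · by_cases h' : l w = l v <;> simp [h', h, -LaurentPolynomial.single_eq_C_mul_T]

open Polynomial in
/-- An additive functional that is nonnegative on the exponents `g x`, `x : M`, is nonnegative on
the exponents of every element integral over the image of `k[M]`. -/
theorem nonneg_of_isIntegralElem [IsDomain (AddMonoidAlgebra k N)]
    [IsIntegrallyClosed (AddMonoidAlgebra k N)[X]] (g : M →+ N) (l : N →+ ℤ) (m : M →+ ℕ)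
    (hm : ∀ x, l (g x) = m x) {f : AddMonoidAlgebra k N}
    (hf : (mapDomainRingHom k g).IsIntegralElem f) {v : N} (hv : f.coeff v ≠ 0) : 0 ≤ l v := by
  let φ : AddMonoidAlgebra k M →ₐ[k] (AddMonoidAlgebra k N)[X] :=
    AddMonoidAlgebra.lift k _ M
      { toFun x := monomial (m x.toAdd) (single (g x.toAdd) 1)
        map_one' := by simp [← one_def]
        map_mul' v w := by simp [monomial_mul_monomial, single_mul_single] }
  have hφ : (toLaurent : (AddMonoidAlgebra k N)[X] →+* _).comp φ.toRingHom =
      (toLaurentOfHom k l).toRingHom.comp (mapDomainRingHom k g) := by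
    have (x : M) (c : k) : toLaurent (φ (single x c)) =
        toLaurentOfHom k l (mapDomain g (single x c)) := by
      rw [mapDomain_single, toLaurentOfHom_single, hm]
      simp only [φ, lift_single, MonoidHom.coe_mk, OneHom.coe_mk, toAdd_ofAdd, smul_monomial]
      rw [← C_mul_X_pow_eq_monomial, toLaurent_C_mul_X_pow, ← LaurentPolynomial.single_eq_C_mul_T]
      simp
    refine RingHom.ext fun x => ?_
    induction x using AddMonoidAlgebra.induction_linear with
    | zero => simp
    | add f g hf hg => rw [map_add, map_add, hf, hg]
    | single w c => exact this w c
  obtain ⟨P, hP, h0⟩ := hf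
  obtain ⟨p, hp⟩ := LaurentPolynomial.exists_toLaurent_eq_of_isIntegralElem
    (f := toLaurentOfHom k l f) ⟨P.map φ.toRingHom, hP.map _, by
      rw [eval₂_map, hφ]
      have := congrArg (toLaurentOfHom k l).toRingHom h0
      rwa [hom_eval₂, map_zero] at this⟩
  by_contra! hneg
  apply hv
  rw [← coeff_toLaurentOfHom l, ← hp, LaurentPolynomial.coeff_toLaurent,
    Finsupp.mapDomain_of_notMem_range]
  · simp
  · rintro ⟨j, hj⟩
    have : (j : ℤ) = l v := hj
    lia

theorem mapDomainRingHom_injective {g : M →+ N} (hg : Function.Injective g) :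
    Function.Injective (mapDomainRingHom k g) :=
  mapDomain_injective hg

/-- If the submonoid `g(M)` of `N` is cut out by additive functionals, then `k[M]` is integrally
closed as soon as `k[N]` and `k[N][X]` are. -/
theorem isIntegrallyClosed_of_functionals [IsDomain (AddMonoidAlgebra k N)]
    [IsIntegrallyClosed (AddMonoidAlgebra k N)]
    [IsIntegrallyClosed (Polynomial (AddMonoidAlgebra k N))] {ι : Type*} (g : M →+ N)
    (hg : Function.Injective g) (l : ι → N →+ ℤ) (m : ι → M →+ ℕ)
    (hm : ∀ i x, l i (g x) = m i x) (hrange : ∀ v, (∀ i, 0 ≤ l i v) → v ∈ Set.range g) :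
    IsIntegrallyClosed (AddMonoidAlgebra k M) := by
  have hinj := mapDomainRingHom_injective (k := k) hg
  let : Algebra (AddMonoidAlgebra k M) (AddMonoidAlgebra k N) := (mapDomainRingHom k g).toAlgebra
  have : FaithfulSMul (AddMonoidAlgebra k M) (AddMonoidAlgebra k N) :=
    (faithfulSMul_iff_algebraMap_injective _ _).mpr hinj
  have : IsIntegrallyClosedIn (AddMonoidAlgebra k M) (AddMonoidAlgebra k N) := by
    refine isIntegrallyClosedIn_iff.mpr ⟨hinj, fun {f} hf => ⟨comapDomain g hg f, ?_⟩⟩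
    refine mapDomain_comapDomain (fun v hv => hrange v fun i => ?_) hg
    exact nonneg_of_isIntegralElem g (l i) (m i) (hm i) hf (by simpa using hv)
  exact IsIntegrallyClosed.of_isIntegrallyClosed_of_isIntegrallyClosedIn _
    (AddMonoidAlgebra k N)

end AddMonoidAlgebra

/-- Given a chain of primes `p₀ ≤ ⋯ ≤ pₗ` and `yᵢ ∈ pᵢ₊₁ \ pᵢ`, a polynomial relation among the
`yᵢ` modulo `p₀` is trivial. -/
theorem MvPolynomial.eq_zero_of_aeval_mem_of_chain {k R : Type*} [Field k] [CommRing R]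
    [Algebra k R] : ∀ {l : ℕ} (p : Fin (l + 1) → Ideal R) (_ : ∀ i, (p i).IsPrime)
    (_ : Monotone p) (y : Fin l → R) (_ : ∀ i, y i ∈ p i.succ) (_ : ∀ i, y i ∉ p i.castSucc)
    (f : MvPolynomial (Fin l) k) (_ : aeval y f ∈ p 0), f = 0
  | 0, p, hp, _, y, _, _, f, hf => by
    obtain ⟨c, rfl⟩ := C_surjective (Fin 0) f
    by_contra hc
    rw [aeval_C] at hf
    refine (hp 0).ne_top (Ideal.eq_top_of_isUnit_mem _ hf (IsUnit.map _ ?_))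
    exact isUnit_iff_ne_zero.mpr fun h => hc (by rw [h, C_0])
  | l + 1, p, hp, hmono, y, hy, hy', f, hf => by
    by_contra hne
    have hF : finSuccEquiv k l f ≠ 0 := by simpa using hne
    obtain ⟨G, hG, hGX⟩ := Polynomial.exists_eq_pow_rootMultiplicity_mul_and_not_dvd _ hF 0
    rw [Polynomial.C_0, sub_zero] at hG hGX
    let θ : Polynomial (MvPolynomial (Fin l) k) →+* R :=
      Polynomial.eval₂RingHom (aeval fun i => y i.succ).toRingHom (y 0)
    have hθ : aeval y f = θ (finSuccEquiv k l f) := by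
      have : (aeval y : MvPolynomial (Fin (l + 1)) k →ₐ[k] R).toRingHom =
          θ.comp (finSuccEquiv k l).toRingEquiv.toRingHom := by
        refine ringHom_ext (fun c => ?_) (fun i => ?_)
        · simp [θ, finSuccEquiv_apply]
        · refine Fin.cases ?_ (fun i => ?_) i <;> simp [θ, finSuccEquiv_X_zero, finSuccEquiv_X_succ]
      exact congrArg (fun h : _ →+* R => h f) this
    rw [hθ, hG, map_mul, map_pow] at hf
    have hX : θ Polynomial.X = y 0 := by simp [θ]
    have hGmem : θ G ∈ p 0 := by
      rcases (hp 0).mem_or_mem hf with h | h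
      · exact absurd ((hp 0).mem_of_pow_mem _ h) (by rw [hX]; exact hy' 0)
      · exact h
    apply hGX
    rw [Polynomial.X_dvd_iff]
    refine eq_zero_of_aeval_mem_of_chain (fun i => p i.succ) (fun i => hp _)
      (fun i j hij => hmono (Fin.succ_le_succ_iff.mpr hij)) (fun i => y i.succ)
      (fun i => hy _) (fun i => hy' i.succ) _ ?_
    have h1 : θ G ∈ p 1 := hmono (Fin.zero_le _) hGmem
    rw [← Polynomial.divX_mul_X_add G, map_add, map_mul, hX] at h1
    have h2 := (Ideal.add_mem_iff_right _ (Ideal.mul_mem_left _ (θ G.divX) (hy 0))).mp h1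
    simpa [θ] using h2

/-- The Krull dimension of an algebra over a field is at most any natural number bounding its
transcendence degree. -/
theorem ringKrullDim_le_of_trdeg_le {k R : Type*} [Field k] [CommRing R] [Algebra k R]
    {d : ℕ} (hd : Algebra.trdeg k R ≤ d) : ringKrullDim R ≤ d := by
  refine iSup_le fun s => ?_
  have hlt (i : Fin s.length) : (s i.castSucc).asIdeal < (s i.succ).asIdeal := s.step i
  choose y hy hy' using fun i => SetLike.exists_of_lt (hlt i)
  have hy_ind : AlgebraicIndependent k y := by
    rw [algebraicIndependent_iff]
    intro f hf
    exact MvPolynomial.eq_zero_of_aeval_mem_of_chain (fun i => (s i).asIdeal)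
      (fun i => (s i).isPrime) (fun i j hij => s.monotone hij) y hy hy' f (by simp [hf])
  have := hy_ind.lift_cardinalMk_le_trdeg.trans (Cardinal.lift_le.mpr hd)
  simp at this
  exact_mod_cast this

namespace Qmon

variable {n : ℕ} {a b : Fin n → ℕ}

/-- The inclusion of `Q(a,b)` in the monoid of exponents of monomials in `n + 2` variables. -/
noncomputable def toFinsupp (n : ℕ) (a b : Fin n → ℕ) : Qmon n a b →+ (Fin (n + 2) →₀ ℕ) where
  toFun x := Finsupp.equivFunOnFinite.symm x.1
  map_zero' := by ext; simp
  map_add' x y := by ext; simp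

@[simp]
theorem toFinsupp_apply (x : Qmon n a b) (i : Fin (n + 2)) : toFinsupp n a b x i = x.1 i := rfl

theorem toFinsupp_injective : Function.Injective (toFinsupp n a b) := fun _ _ h =>
  Subtype.ext (funext fun i => DFunLike.congr_fun h i)

theorem mul_zero_le (x : Qmon n a b) (i : Fin n) : a i * x.1 0 ≤ x.1 i.succ.succ :=
  (le_max_left _ _).trans (x.2 i)

theorem mul_one_le (x : Qmon n a b) (i : Fin n) : b i * x.1 1 ≤ x.1 i.succ.succ :=
  (le_max_right _ _).trans (x.2 i)

/-- The functional `t_i - c * x_j`. -/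
noncomputable def functional (i : Fin n) (c : ℕ) (j : Fin (n + 2)) : (Fin (n + 2) →₀ ℕ) →+ ℤ where
  toFun v := (v i.succ.succ : ℤ) - c * v j
  map_zero' := by simp
  map_add' v w := by simp; ring

/-- A functional `t_i - c * x_j` that is nonnegative on `Q(a,b)`, with values in `ℕ`. -/
def natFunctional (i : Fin n) (c : ℕ) (j : Fin (n + 2))
    (h : ∀ x : Qmon n a b, c * x.1 j ≤ x.1 i.succ.succ) : Qmon n a b →+ ℕ where
  toFun x := x.1 i.succ.succ - c * x.1 j
  map_zero' := by simp
  map_add' x y := by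
    have hx := h x
    have hy := h y
    simp only [AddSubmonoid.coe_add, Pi.add_apply, mul_add]
    lia

theorem isIntegrallyClosed (k : Type*) [Field k] (n : ℕ) (a b : Fin n → ℕ) :
    IsIntegrallyClosed (AddMonoidAlgebra k (Qmon n a b)) := by
  refine AddMonoidAlgebra.isIntegrallyClosed_of_functionals (ι := Fin n ⊕ Fin n) (toFinsupp n a b)
    toFinsupp_injective
    (Sum.elim (fun i => functional i (a i) 0) (fun i => functional i (b i) 1))
    (Sum.elim (fun i => natFunctional i (a i) 0 (mul_zero_le · i))
      (fun i => natFunctional i (b i) 1 (mul_one_le · i))) ?_ ?_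
  · rintro (i | i) x
    · have := mul_zero_le x i
      simp [functional, natFunctional, Nat.cast_sub this]
    · have := mul_one_le x i
      simp [functional, natFunctional, Nat.cast_sub this]
  · intro v hv
    refine ⟨⟨v, fun i => max_le ?_ ?_⟩, by ext; simp⟩
    · have := hv (.inl i)
      simp only [functional, Sum.elim_inl, AddMonoidHom.coe_mk, ZeroHom.coe_mk] at this
      zify
      linarith
    · have := hv (.inr i)
      simp only [functional, Sum.elim_inr, AddMonoidHom.coe_mk, ZeroHom.coe_mk] at this
      zify
      linarith

/-- The embedding of `k[Q(a,b)]` in the polynomial ring in `n + 2` variables. -/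
noncomputable def toMvPolynomial (k : Type*) [Field k] (n : ℕ) (a b : Fin n → ℕ) :
    AddMonoidAlgebra k (Qmon n a b) →ₐ[k] MvPolynomial (Fin (n + 2)) k :=
  AddMonoidAlgebra.mapDomainAlgHom k k (toFinsupp n a b)

theorem toMvPolynomial_injective (k : Type*) [Field k] (n : ℕ) (a b : Fin n → ℕ) :
    Function.Injective (toMvPolynomial k n a b) :=
  AddMonoidAlgebra.mapDomain_injective toFinsupp_injective

theorem toMvPolynomial_single (k : Type*) [Field k] (x : Qmon n a b) :
    toMvPolynomial k n a b (.single x 1) = ∏ i, MvPolynomial.X i ^ x.1 i := by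
  have : toMvPolynomial k n a b (.single x 1) = MvPolynomial.monomial (toFinsupp n a b x) 1 :=
    AddMonoidAlgebra.mapDomain_single
  rw [this, MvPolynomial.monomial_eq, Finsupp.prod_fintype _ _ (by simp)]
  simp

/-- The exponent vector `(1, 1, max(a_i, b_i))` with the entries below `j` replaced by `0`. -/
def corner (a b : Fin n → ℕ) (j : ℕ) : Qmon n a b where
  val i := if (i : ℕ) < j then 0 else
    Matrix.vecCons 1 (Matrix.vecCons 1 fun i => max (a i) (b i)) i
  property i := by
    simp only [Matrix.cons_val_succ, Matrix.cons_val_zero, Matrix.cons_val_one, Fin.val_succ,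
      Fin.val_zero, Fin.val_one]
    split_ifs <;> simp <;> lia

theorem corner_of_lt (i : Fin (n + 2)) {j : ℕ} (h : (i : ℕ) < j) : (corner a b j).1 i = 0 :=
  if_pos h

theorem corner_pos (ha : ∀ i, 0 < a i) (i : Fin (n + 2)) : 0 < (corner a b i).1 i := by
  simp only [corner, lt_irrefl, if_false]
  refine Fin.cases (by simp) (fun i => ?_) i
  refine Fin.cases (by simp) (fun i => ?_) i
  simpa using Or.inl (ha i)

/-- The algebra map killing the monomials in `Q(a,b)` involving a variable of index below `j`. -/
noncomputable def restrict (k : Type*) [Field k] (n : ℕ) (a b : Fin n → ℕ) (j : ℕ) :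
    AddMonoidAlgebra k (Qmon n a b) →ₐ[k] MvPolynomial (Fin (n + 2)) k :=
  (MvPolynomial.aeval fun i : Fin (n + 2) =>
    if (i : ℕ) < j then (0 : MvPolynomial (Fin (n + 2)) k) else MvPolynomial.X i).comp
      (toMvPolynomial k n a b)

theorem ker_restrict_mono (k : Type*) [Field k] {j j' : ℕ} (h : j ≤ j') :
    RingHom.ker (restrict k n a b j) ≤ RingHom.ker (restrict k n a b j') := by
  have : restrict k n a b j' = (MvPolynomial.aeval fun i : Fin (n + 2) =>
    if (i : ℕ) < j' then (0 : MvPolynomial (Fin (n + 2)) k) else MvPolynomial.X i).comp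
      (restrict k n a b j) := by
    rw [restrict, restrict, ← AlgHom.comp_assoc]
    congr 1
    ext1 i
    by_cases hi : (i : ℕ) < j
    · simp [hi, hi.trans_le h]
    · simp [hi]
  intro f hf
  rw [RingHom.mem_ker] at hf ⊢
  rw [this, AlgHom.comp_apply, hf, map_zero]

theorem restrict_single (k : Type*) [Field k] (j : ℕ) (x : Qmon n a b) :
    restrict k n a b j (.single x 1) =
      ∏ i : Fin (n + 2), (if (i : ℕ) < j then 0 else MvPolynomial.X i) ^ x.1 i := by
  simp [restrict, toMvPolynomial_single]

theorem ker_restrict_lt (k : Type*) [Field k] (ha : ∀ i, 0 < a i) (j : Fin (n + 2)) :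
    RingHom.ker (restrict k n a b j) < RingHom.ker (restrict k n a b (j + 1)) := by
  refine SetLike.lt_iff_le_and_exists.mpr
    ⟨ker_restrict_mono k (Nat.le_succ _), .single (corner a b j) 1, ?_, ?_⟩
  · rw [RingHom.mem_ker, restrict_single]
    refine Finset.prod_eq_zero (Finset.mem_univ j) ?_
    simp [(corner_pos ha j).ne']
  · rw [RingHom.mem_ker, restrict_single, Finset.prod_eq_zero_iff]
    rintro ⟨i, -, hi⟩
    by_cases h : (i : ℕ) < j
    · simp [corner_of_lt i h] at hi
    · simp [h] at hi

theorem le_ringKrullDim (k : Type*) [Field k] (ha : ∀ i, 0 < a i) :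
    ((n + 2 : ℕ) : WithBot ℕ∞) ≤ ringKrullDim (AddMonoidAlgebra k (Qmon n a b)) :=
  let chain : LTSeries (PrimeSpectrum (AddMonoidAlgebra k (Qmon n a b))) :=
    { length := n + 2
      toFun j := ⟨RingHom.ker (restrict k n a b j), RingHom.ker_isPrime _⟩
      step j := ker_restrict_lt (b := b) k ha j }
  Order.LTSeries.length_le_krullDim chain

theorem ringKrullDim_le (k : Type*) [Field k] (n : ℕ) (a b : Fin n → ℕ) :
    ringKrullDim (AddMonoidAlgebra k (Qmon n a b)) ≤ ((n + 2 : ℕ) : WithBot ℕ∞) := by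
  refine ringKrullDim_le_of_trdeg_le (k := k) ?_
  refine (trdeg_le_of_injective _ (toMvPolynomial_injective k n a b)).trans ?_
  simp [MvPolynomial.trdeg_of_isDomain]

end Qmon

/-- for a field `k` and positive integer vectors `a, b` of length `n ≥ 1`, the
monoid algebra `k[Q(a,b)]` is an integrally closed integral domain of Krull dimension `n+2`. -/
theorem monoidAlgebra_Q_normal_domain_dim (k : Type*) [Field k] (n : ℕ) (hn : 1 ≤ n)
    (a b : Fin n → ℕ) (ha : ∀ i, 0 < a i) (hb : ∀ i, 0 < b i) :
    IsDomain (AddMonoidAlgebra k (Qmon n a b)) ∧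
    IsIntegrallyClosed (AddMonoidAlgebra k (Qmon n a b)) ∧
    ringKrullDim (AddMonoidAlgebra k (Qmon n a b)) = n + 2 := by
  refine ⟨(Qmon.toMvPolynomial_injective k n a b).isDomain (Qmon.toMvPolynomial k n a b).toRingHom,
    Qmon.isIntegrallyClosed k n a b, ?_⟩
  exact_mod_cast (Qmon.ringKrullDim_le k n a b).antisymm (Qmon.le_ringKrullDim k ha)
end

section
/- Let n ≥ 1 and let a = (a_1,…,a_n), b = (b_1,…,b_n) be positive integer vectors. Let f : ℤ^{n+2} → ℤ^{2n+2} be the ℤ-linear map f(r, s, t_1,…,t_n) = (r, s, t_1 − a_1 r,…, t_n − a_n r, t_1 − b_1 s,…, t_n − b_n s) (i.e., the map given by pairing with e_1, e_2, α_1,…,α_n, β_1,…,β_n). Then the quotient group ℤ^{2n+2} / image(f) is isomorphic to ℤ^n. (This computes the divisor class group: Cl(B(a,b)) ≅ ℤ^n.) -/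
/-- The ℤ-linear map `f : ℤ^(n+2) → ℤ^(2n+2)`,
`f(r,s,t_1,…,t_n) = (r, s, (t_i - a_i r)_i, (t_i - b_i s)_i)`, i.e. pairing with
`e_1, e_2, α_1,…,α_n, β_1,…,β_n`. The codomain `ℤ × ℤ × ℤ^n × ℤ^n` is `ℤ^(2n+2)`. -/
def facetMap (n : ℕ) (a b : Fin n → ℕ) :
    (Fin (n + 2) → ℤ) →+ (ℤ × ℤ × (Fin n → ℤ) × (Fin n → ℤ)) :=
  AddMonoidHom.mk'
    (fun x => (x 0, x 1,
      fun i => x i.succ.succ - (a i : ℤ) * x 0,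
      fun i => x i.succ.succ - (b i : ℤ) * x 1))
    (by
      intro x y
      refine Prod.ext rfl (Prod.ext rfl (Prod.ext ?_ ?_)) <;>
        · funext i
          simp only [Prod.mk_add_mk, Pi.add_apply]
          ring)

/-- The map `(r, s, u, v) ↦ u + a r - v - b s`, a cokernel of `facetMap n a b`. -/
def facetCokernelMap (n : ℕ) (a b : Fin n → ℕ) :
    (ℤ × ℤ × (Fin n → ℤ) × (Fin n → ℤ)) →+ (Fin n → ℤ) :=
  AddMonoidHom.mk'
    (fun y i => y.2.2.1 i + (a i : ℤ) * y.1 - y.2.2.2 i - (b i : ℤ) * y.2.1)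
    (by
      intro x y
      funext i
      simp only [Prod.fst_add, Prod.snd_add, Pi.add_apply]
      ring)

theorem facetCokernelMap_surjective (n : ℕ) (a b : Fin n → ℕ) :
    Function.Surjective (facetCokernelMap n a b) := fun w =>
  ⟨(0, 0, w, 0), by funext i; simp [facetCokernelMap]⟩

theorem range_facetMap_eq_ker (n : ℕ) (a b : Fin n → ℕ) :
    (facetMap n a b).range = (facetCokernelMap n a b).ker := by
  ext y
  rw [AddMonoidHom.mem_range, AddMonoidHom.mem_ker]
  constructor
  · rintro ⟨x, rfl⟩
    funext i
    simp only [facetMap, facetCokernelMap, AddMonoidHom.mk'_apply, Pi.zero_apply]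
    ring
  · obtain ⟨r, s, u, v⟩ := y
    intro h
    refine ⟨Fin.cons r (Fin.cons s fun i => u i + (a i : ℤ) * r), ?_⟩
    refine Prod.ext rfl (Prod.ext rfl (Prod.ext ?_ ?_)) <;> funext i
    · change u i + (a i : ℤ) * r - (a i : ℤ) * r = u i
      ring
    · have hi : u i + (a i : ℤ) * r - v i - (b i : ℤ) * s = 0 := congrFun h i
      change u i + (a i : ℤ) * r - (b i : ℤ) * s = v i
      linarith

/-- the quotient of `ℤ^(2n+2)` by the image of `f` is isomorphic to `ℤ^n`.
(This computes the divisor class group `Cl(B(a,b)) ≅ ℤ^n`.) -/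
theorem quotient_by_facetMap_iso (n : ℕ) (hn : 1 ≤ n) (a b : Fin n → ℕ)
    (ha : ∀ i, 0 < a i) (hb : ∀ i, 0 < b i) :
    Nonempty (((ℤ × ℤ × (Fin n → ℤ) × (Fin n → ℤ)) ⧸ (facetMap n a b).range) ≃+
      (Fin n → ℤ)) := by
  exact ⟨(QuotientAddGroup.quotientAddEquivOfEq (range_facetMap_eq_ker n a b)).trans
    (QuotientAddGroup.quotientKerEquivOfSurjective _ (facetCokernelMap_surjective n a b))⟩
end

section
/- Let n ≥ 1 and let a = (a_1,…,a_n), b = (b_1,…,b_n) be positive integer vectors. There exists a vector ω ∈ ℝ^{n+2} such that ⟨ω, e_1⟩ = ⟨ω, e_2⟩ = ⟨ω, α_i⟩ = ⟨ω, β_i⟩ = 1 for all i = 1,…,n if and only if a_i = b_i for every i = 1,…,n. (By the standard criterion for toric rings, this says the intersection algebra B(a,b) is ℚ-Gorenstein if and only if a = b.) -/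
open Finset

theorem dotR_smul_single_add_single (n : ℕ) (ω : Fin (n + 2) → ℝ) (c : ℝ) (j k : Fin (n + 2)) :
    dotR n ω (c • (Pi.single j 1 : Fin (n + 2) → ℝ) + (Pi.single k 1 : Fin (n + 2) → ℝ)) =
      c * ω j + ω k := by
  simp [dotR, Pi.single_apply, mul_add, Finset.sum_add_distrib, mul_comm]

theorem dotR_single_one (n : ℕ) (ω : Fin (n + 2) → ℝ) (j : Fin (n + 2)) :
    dotR n ω (Pi.single j 1) = ω j := by
  simp [dotR, Pi.single_apply]

/-- there exists `ω ∈ ℝ^(n+2)` with `⟨ω,e_1⟩ = ⟨ω,e_2⟩ = ⟨ω,α_i⟩ = ⟨ω,β_i⟩ = 1`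
for all `i` if and only if `a_i = b_i` for every `i`.  (This is the standard criterion for the
intersection algebra `B(a,b)` to be ℚ-Gorenstein.) -/
theorem qGorenstein_iff (n : ℕ) (hn : 1 ≤ n) (a b : Fin n → ℕ)
    (ha : ∀ i, 0 < a i) (hb : ∀ i, 0 < b i) :
    (∃ ω : Fin (n + 2) → ℝ,
      dotR n ω (Pi.single 0 1) = 1 ∧
      dotR n ω (Pi.single 1 1) = 1 ∧
      ∀ i : Fin n, dotR n ω (alphaVec n a i) = 1 ∧ dotR n ω (betaVec n b i) = 1) ↔
    (∀ i, a i = b i) := by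
  simp only [alphaVec, betaVec, dotR_smul_single_add_single, dotR_single_one]
  constructor
  · rintro ⟨ω, h0, h1, h⟩ i
    obtain ⟨hα, hβ⟩ := h i
    rw [h0] at hα
    rw [h1] at hβ
    exact_mod_cast (by linarith : (a i : ℝ) = b i)
  · intro h
    refine ⟨Fin.cons 1 (Fin.cons 1 fun i => 1 + (a i : ℝ)), rfl, rfl, fun i => ⟨?_, ?_⟩⟩
    · change -(a i : ℝ) * 1 + (1 + (a i : ℝ)) = 1
      ring
    · change -(b i : ℝ) * 1 + (1 + (a i : ℝ)) = 1
      rw [h i]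
      ring
end

section
/- Let k be a field, n ≥ 1, and let a = (a_1,…,a_n) be a positive integer vector. Let φ : k[X_1,…,X_n, A, B, C] → k[x_1,…,x_n, u, v] be the k-algebra homomorphism determined by φ(X_i) = x_i for i = 1,…,n, φ(A) = x_1^{a_1}⋯x_n^{a_n}·u, φ(B) = x_1^{a_1}⋯x_n^{a_n}·v, and φ(C) = x_1^{a_1}⋯x_n^{a_n}·uv. Then the kernel of φ is the principal ideal generated by AB − X_1^{a_1}⋯X_n^{a_n}·C. (Hence the intersection algebra B(a,a), which is the image of φ, is a hypersurface: B(a,a) ≅ k[X_1,…,X_n,A,B,C]/(AB − X_1^{a_1}⋯X_n^{a_n}C).) -/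
open MvPolynomial

lemma MvPolynomial.monomial_one_eq_prod_sum {k : Type*} [CommSemiring k] {σ τ : Type*}
    [Fintype σ] [Fintype τ] (s : σ ⊕ τ →₀ ℕ) :
    monomial s (1 : k) = (∏ i, X (Sum.inl i) ^ s (Sum.inl i)) *
      ∏ j, X (Sum.inr j) ^ s (Sum.inr j) := by
  rw [monomial_eq, C_1, one_mul, Finsupp.prod_fintype _ _ (fun _ => pow_zero _),
    Fintype.prod_sum_type]

/-- The exponent vector of `φ` applied to the monomial with exponent vector `s`. -/
noncomputable def imageExponent {n : ℕ} (a : Fin n → ℕ) (s : Fin n ⊕ Fin 3 →₀ ℕ) :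
    Fin n ⊕ Fin 2 →₀ ℕ :=
  Finsupp.equivFunOnFinite.symm (Sum.elim
    (fun i => s (Sum.inl i) + a i * (s (Sum.inr 0) + s (Sum.inr 1) + s (Sum.inr 2)))
    ![s (Sum.inr 0) + s (Sum.inr 2), s (Sum.inr 1) + s (Sum.inr 2)])

/-- The exponent vector of the reduced monomial (one not divisible by `AB`) that `φ` maps
to the monomial with exponent vector `t`, when there is one. -/
noncomputable def reducedExponent {n : ℕ} (a : Fin n → ℕ) (t : Fin n ⊕ Fin 2 →₀ ℕ) :
    Fin n ⊕ Fin 3 →₀ ℕ :=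
  Finsupp.equivFunOnFinite.symm (Sum.elim
    (fun i => t (Sum.inl i) - a i * max (t (Sum.inr 0)) (t (Sum.inr 1)))
    ![t (Sum.inr 0) - t (Sum.inr 1), t (Sum.inr 1) - t (Sum.inr 0),
      min (t (Sum.inr 0)) (t (Sum.inr 1))])

lemma reducedExponent_imageExponent {n : ℕ} (a : Fin n → ℕ) (s : Fin n ⊕ Fin 3 →₀ ℕ) :
    reducedExponent a (imageExponent a s) = Finsupp.equivFunOnFinite.symm (Sum.elim
      (fun i => s (Sum.inl i) + a i * min (s (Sum.inr 0)) (s (Sum.inr 1)))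
      ![s (Sum.inr 0) - s (Sum.inr 1), s (Sum.inr 1) - s (Sum.inr 0),
        s (Sum.inr 2) + min (s (Sum.inr 0)) (s (Sum.inr 1))]) := by
  ext (i | j)
  · simp only [reducedExponent, imageExponent, Finsupp.equivFunOnFinite_symm_apply_apply,
      Sum.elim_inl, Sum.elim_inr, Matrix.cons_val_zero, Matrix.cons_val_one]
    have h : s (Sum.inr 0) + s (Sum.inr 1) + s (Sum.inr 2) =
        min (s (Sum.inr 0)) (s (Sum.inr 1)) +
        max (s (Sum.inr 0) + s (Sum.inr 2)) (s (Sum.inr 1) + s (Sum.inr 2)) := by omega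
    rw [h, mul_add, ← add_assoc, Nat.add_sub_cancel]
  · fin_cases j <;> simp [reducedExponent, imageExponent] <;> omega

lemma mul_pow_eq_of_mul_eq {R : Type*} [CommRing R] {A B C P : R} (h : A * B = P * C)
    (p q r : ℕ) :
    A ^ p * B ^ q * C ^ r =
      P ^ min p q * (A ^ (p - q) * B ^ (q - p) * C ^ (r + min p q)) := by
  have key (m : ℕ) : A ^ m * B ^ m = P ^ m * C ^ m := by rw [← mul_pow, h, mul_pow]
  rcases le_total p q with hpq | hpq
  · obtain ⟨d, rfl⟩ := Nat.exists_eq_add_of_le hpq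
    simp only [hpq, min_eq_left, Nat.add_sub_cancel_left, Nat.sub_eq_zero_of_le, pow_zero]
    linear_combination B ^ d * C ^ r * key p
  · obtain ⟨d, rfl⟩ := Nat.exists_eq_add_of_le hpq
    simp only [hpq, min_eq_right, Nat.add_sub_cancel_left, Nat.sub_eq_zero_of_le, pow_zero]
    linear_combination A ^ d * C ^ r * key q

lemma mk_monomial_reducedExponent {k : Type*} [CommRing k] {n : ℕ} (a : Fin n → ℕ)
    {I : Ideal (MvPolynomial (Fin n ⊕ Fin 3) k)}
    (hI : X (Sum.inr 0) * X (Sum.inr 1) -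
      (∏ i : Fin n, X (Sum.inl i) ^ a i) * X (Sum.inr 2) ∈ I) (s : Fin n ⊕ Fin 3 →₀ ℕ) :
    Ideal.Quotient.mk I (monomial (reducedExponent a (imageExponent a s)) 1) =
      Ideal.Quotient.mk I (monomial s 1) := by
  have h := (Ideal.Quotient.eq (I := I)).2 hI
  rw [map_mul, map_mul] at h
  simp only [reducedExponent_imageExponent, monomial_one_eq_prod_sum, Fin.prod_univ_three,
    Finsupp.equivFunOnFinite_symm_apply_apply, Sum.elim_inl, Sum.elim_inr,
    Matrix.cons_val_zero, Matrix.cons_val_one, Matrix.cons_val, pow_add, pow_mul,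
    Finset.prod_mul_distrib, Finset.prod_pow]
  have h2 := mul_pow_eq_of_mul_eq h (s (Sum.inr 0)) (s (Sum.inr 1)) (s (Sum.inr 2))
  rw [pow_add] at h2
  simp only [map_mul, map_pow] at h2 ⊢
  rw [h2]
  ring

lemma aeval_monomial_eq_imageExponent {k : Type*} [CommRing k] {n : ℕ} (a : Fin n → ℕ)
    (s : Fin n ⊕ Fin 3 →₀ ℕ) :
    aeval (R := k) (S₁ := MvPolynomial (Fin n ⊕ Fin 2) k)
      (Sum.elim (fun i => X (Sum.inl i))
      (fun j : Fin 3 =>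
        if j = 0 then (∏ i : Fin n, X (Sum.inl i) ^ a i) * X (Sum.inr 0)
        else if j = 1 then (∏ i : Fin n, X (Sum.inl i) ^ a i) * X (Sum.inr 1)
        else (∏ i : Fin n, X (Sum.inl i) ^ a i) * X (Sum.inr 0) * X (Sum.inr 1)))
      (monomial s 1) = monomial (imageExponent a s) 1 := by
  rw [aeval_monomial, map_one, one_mul, Finsupp.prod_fintype _ _ (fun _ => pow_zero _),
    Fintype.prod_sum_type, monomial_one_eq_prod_sum]
  simp only [imageExponent, Fin.prod_univ_three, Fin.prod_univ_two,
    Finsupp.equivFunOnFinite_symm_apply_apply, Sum.elim_inl, Sum.elim_inr,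
    Matrix.cons_val_zero, Matrix.cons_val_one, pow_add, pow_mul,
    Finset.prod_mul_distrib, Finset.prod_pow, if_true, one_ne_zero, if_false,
    show (2 : Fin 3) ≠ 0 by decide, show (2 : Fin 3) ≠ 1 by decide, mul_pow]
  ring

/-- Let `φ : k[X_1,…,X_n,A,B,C] → k[x_1,…,x_n,u,v]` be the `k`-algebra map with
`φ(X_i) = x_i`, `φ(A) = x_1^{a_1}⋯x_n^{a_n} u`, `φ(B) = x_1^{a_1}⋯x_n^{a_n} v`,
`φ(C) = x_1^{a_1}⋯x_n^{a_n} uv`.  Then `ker φ = (AB - X_1^{a_1}⋯X_n^{a_n} C)`.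
Here the source has variables indexed by `Fin n ⊕ Fin 3` (`inl i = X_i`, `inr 0 = A`,
`inr 1 = B`, `inr 2 = C`) and the target by `Fin n ⊕ Fin 2` (`inl i = x_i`, `inr 0 = u`,
`inr 1 = v`). -/
theorem ker_phi_eq_span_hypersurface (k : Type*) [Field k] (n : ℕ) (hn : 1 ≤ n)
    (a : Fin n → ℕ) (ha : ∀ i, 0 < a i)
    (φ : MvPolynomial (Fin n ⊕ Fin 3) k →ₐ[k] MvPolynomial (Fin n ⊕ Fin 2) k)
    (hφ : φ = aeval (Sum.elim (fun i => X (Sum.inl i))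
      (fun j : Fin 3 =>
        if j = 0 then (∏ i : Fin n, X (Sum.inl i) ^ a i) * X (Sum.inr 0)
        else if j = 1 then (∏ i : Fin n, X (Sum.inl i) ^ a i) * X (Sum.inr 1)
        else (∏ i : Fin n, X (Sum.inl i) ^ a i) * X (Sum.inr 0) * X (Sum.inr 1)))) :
    RingHom.ker (φ : MvPolynomial (Fin n ⊕ Fin 3) k →+* MvPolynomial (Fin n ⊕ Fin 2) k) =
      Ideal.span {X (Sum.inr 0) * X (Sum.inr 1) -
        (∏ i : Fin n, X (Sum.inl i) ^ a i) * X (Sum.inr 2)} := by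
  have hφ_monomial (s) : φ (monomial s 1) = monomial (imageExponent a s) 1 := by
    rw [hφ, aeval_monomial_eq_imageExponent]
  set I : Ideal (MvPolynomial (Fin n ⊕ Fin 3) k) := Ideal.span {X (Sum.inr 0) * X (Sum.inr 1) -
    (∏ i : Fin n, X (Sum.inl i) ^ a i) * X (Sum.inr 2)} with hI
  apply le_antisymm
  · intro p hp
    let L : MvPolynomial (Fin n ⊕ Fin 2) k →ₗ[k] MvPolynomial (Fin n ⊕ Fin 3) k ⧸ I :=
      (basisMonomials _ k).constr k
        (fun t => Ideal.Quotient.mk I (monomial (reducedExponent a t) 1))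
    have hL (t) : L (monomial t 1) = Ideal.Quotient.mk I (monomial (reducedExponent a t) 1) := by
      simpa using (basisMonomials _ k).constr_basis k
        (fun t => Ideal.Quotient.mk I (monomial (reducedExponent a t) 1)) t
    have key : L ∘ₗ φ.toLinearMap = (Ideal.Quotient.mkₐ k I).toLinearMap := by
      refine (basisMonomials _ k).ext fun s => ?_
      simp only [coe_basisMonomials, LinearMap.comp_apply, AlgHom.toLinearMap_apply,
        Ideal.Quotient.mkₐ_eq_mk]
      rw [hφ_monomial, hL]
      exact mk_monomial_reducedExponent a (Ideal.mem_span_singleton_self _) s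
    have hkey := LinearMap.congr_fun key p
    have hp0 : φ p = 0 := hp
    rw [LinearMap.comp_apply, AlgHom.toLinearMap_apply, hp0, map_zero] at hkey
    exact Ideal.Quotient.eq_zero_iff_mem.1 hkey.symm
  · rw [hI, Ideal.span_singleton_le_iff_mem, RingHom.mem_ker]
    simp [hφ, map_prod]
    ring
end

section
/- Let a ≥ b be positive integers and let P = {(x,y,z) ∈ ℝ³ : 0 ≤ x ≤ 1, 0 ≤ y ≤ 1, max(ax, by) ≤ z ≤ min(1 + ax, 1 + by)}. Then the Lebesgue volume of P equals (6b − 1)/(6ab) when a > b, and equals (3a − 1)/(3a²) when a = b. (By Von Korff's theorem this volume is the F-signature of the intersection algebra B(a,b) for n = 1.) -/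
open MeasureTheory

/-- A truncated power is differentiable, also at the origin, from the exponent two on. -/
theorem hasDerivAt_max_zero_pow (n : ℕ) (t : ℝ) :
    HasDerivAt (fun s : ℝ => max s 0 ^ (n + 2)) ((n + 2 : ℝ) * max t 0 ^ (n + 1)) t := by
  have key : ∀ y : ℝ, y ≠ 0 →
      HasDerivAt (fun s : ℝ => max s 0 ^ (n + 2)) ((n + 2 : ℝ) * max y 0 ^ (n + 1)) y := by
    intro y hy
    rcases lt_or_gt_of_ne hy with h | h
    · rw [max_eq_right h.le, zero_pow (by omega), mul_zero]
      refine (hasDerivAt_const y (0 : ℝ)).congr_of_eventuallyEq ?_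
      filter_upwards [Iio_mem_nhds h] with s hs
      rw [max_eq_right (Set.mem_Iio.1 hs).le, zero_pow (by omega)]
    · rw [max_eq_left h.le]
      have h2 : HasDerivAt (fun s : ℝ => s ^ (n + 2)) ((n + 2 : ℝ) * y ^ (n + 1)) y := by
        simpa using hasDerivAt_pow (n + 2) y
      refine h2.congr_of_eventuallyEq ?_
      filter_upwards [Ioi_mem_nhds h] with s hs
      rw [max_eq_left (Set.mem_Ioi.1 hs).le]
  by_cases ht : t = 0
  · subst ht
    exact hasDerivAt_of_hasDerivAt_of_ne key (by fun_prop) (by fun_prop)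
  · exact key t ht

/-- The second central difference of the truncated power function; for `n = 1` this is the
tent function `max (1 - |t|) 0`. -/
noncomputable def truncPowDiff (n : ℕ) (t : ℝ) : ℝ :=
  max (t + 1) 0 ^ n - 2 * max t 0 ^ n + max (t - 1) 0 ^ n

@[fun_prop]
theorem continuous_truncPowDiff (n : ℕ) : Continuous (truncPowDiff n) := by
  unfold truncPowDiff
  fun_prop

theorem hasDerivAt_truncPowDiff (n : ℕ) (t : ℝ) :
    HasDerivAt (truncPowDiff (n + 2)) ((n + 2 : ℝ) * truncPowDiff (n + 1) t) t := by
  have h1 := (hasDerivAt_max_zero_pow n (t + 1)).comp_add_const t 1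
  have h2 := (hasDerivAt_max_zero_pow n t).const_mul 2
  have h3 := (hasDerivAt_max_zero_pow n (t - 1)).comp_sub_const t 1
  refine ((h1.sub h2).add h3).congr_deriv ?_
  unfold truncPowDiff
  ring

theorem truncPowDiff_one (t : ℝ) : truncPowDiff 1 t = max (1 - |t|) 0 := by
  unfold truncPowDiff
  simp only [pow_one]
  grind

theorem truncPowDiff_three_of_one_le {t : ℝ} (ht : 1 ≤ t) : truncPowDiff 3 t = 6 * t := by
  unfold truncPowDiff
  rw [max_eq_left (by linarith), max_eq_left (by linarith), max_eq_left (by linarith)]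
  ring

theorem truncPowDiff_three_of_le_neg_one {t : ℝ} (ht : t ≤ -1) : truncPowDiff 3 t = 0 := by
  unfold truncPowDiff
  rw [max_eq_right (by linarith), max_eq_right (by linarith), max_eq_right (by linarith)]
  norm_num

theorem truncPowDiff_three_zero : truncPowDiff 3 0 = 1 := by
  norm_num [truncPowDiff]

/-- Integration of a second difference along an affine parametrization. -/
theorem integral_truncPowDiff_add_mul (n : ℕ) (c : ℝ) {d : ℝ} (hd : d ≠ 0) :
    ∫ s in (0 : ℝ)..1, truncPowDiff (n + 1) (c + d * s) =
      (truncPowDiff (n + 2) (c + d) - truncPowDiff (n + 2) c) / ((n + 2) * d) := by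
  have hn : (n + 2 : ℝ) ≠ 0 := by positivity
  have h : ∀ s ∈ Set.uIcc (0 : ℝ) 1,
      HasDerivAt (fun s => truncPowDiff (n + 2) (c + d * s) / ((n + 2) * d))
        (truncPowDiff (n + 1) (c + d * s)) s := by
    intro s _
    have hl : HasDerivAt (fun s : ℝ => c + d * s) d s := by
      simpa using ((hasDerivAt_id s).const_mul d).const_add c
    have := ((hasDerivAt_truncPowDiff n (c + d * s)).comp s hl).div_const ((n + 2) * d)
    refine this.congr_deriv ?_
    field_simp
  rw [intervalIntegral.integral_eq_sub_of_hasDerivAt h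
    (Continuous.intervalIntegrable (by fun_prop) _ _)]
  simp only [mul_one, mul_zero, add_zero]
  ring

theorem integral_integral_truncPowDiff_one {a b : ℝ} (ha : a ≠ 0) (hb : b ≠ 0) :
    ∫ x in (0 : ℝ)..1, ∫ y in (0 : ℝ)..1, truncPowDiff 1 (a * x + -b * y) =
      (truncPowDiff 3 a - truncPowDiff 3 (a - b) + truncPowDiff 3 (-b) - truncPowDiff 3 0) /
        (6 * a * b) := by
  have h (x : ℝ) : ∫ y in (0 : ℝ)..1, truncPowDiff 1 (a * x + -b * y) =
      (truncPowDiff 2 (-b + a * x) - truncPowDiff 2 (0 + a * x)) / (2 * -b) := by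
    have := integral_truncPowDiff_add_mul 0 (a * x) (neg_ne_zero.2 hb)
    rw [add_comm (-b), zero_add]
    simpa using this
  have hcont (c : ℝ) : IntervalIntegrable (fun x => truncPowDiff 2 (c + a * x)) volume 0 1 :=
    Continuous.intervalIntegrable (by fun_prop) _ _
  simp only [h]
  rw [intervalIntegral.integral_div, intervalIntegral.integral_sub (hcont _) (hcont _)]
  have h1 := integral_truncPowDiff_add_mul 1 (-b) ha
  have h2 := integral_truncPowDiff_add_mul 1 0 ha
  norm_num at h1 h2
  norm_num only [zero_add, h1, h2]
  rw [show -b + a = a - b by ring]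
  field_simp
  ring

theorem lintegral_indicator_Icc_ofReal {f : ℝ → ℝ} (hf : Continuous f) (h0 : ∀ x, 0 ≤ f x) :
    ∫⁻ x, (Set.Icc (0 : ℝ) 1).indicator (fun x => ENNReal.ofReal (f x)) x =
      ENNReal.ofReal (∫ x in (0 : ℝ)..1, f x) := by
  rw [lintegral_indicator measurableSet_Icc, intervalIntegral.integral_of_le zero_le_one,
    ← integral_Icc_eq_integral_Ioc, ofReal_integral_eq_lintegral_ofReal
      hf.continuousOn.integrableOn_Icc (Filter.Eventually.of_forall h0)]

/-- The volume of the region is the integral of the tent function over the unit square. -/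
theorem volume_region_eq_integral (a b : ℝ) :
    volume {p : Fin 3 → ℝ | 0 ≤ p 0 ∧ p 0 ≤ 1 ∧ 0 ≤ p 1 ∧ p 1 ≤ 1 ∧
      max (a * p 0) (b * p 1) ≤ p 2 ∧ p 2 ≤ min (1 + a * p 0) (1 + b * p 1)} =
    ENNReal.ofReal (∫ x in (0 : ℝ)..1, ∫ y in (0 : ℝ)..1,
      truncPowDiff 1 (a * x + -b * y)) := by
  set Q : Set (ℝ × ℝ × ℝ) := {q | 0 ≤ q.1 ∧ q.1 ≤ 1 ∧ 0 ≤ q.2.1 ∧ q.2.1 ≤ 1 ∧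
    max (a * q.1) (b * q.2.1) ≤ q.2.2 ∧ q.2.2 ≤ min (1 + a * q.1) (1 + b * q.2.1)} with hQ
  have hQm : MeasurableSet Q := by
    simp only [hQ, Set.ofPred_and]
    refine
      MeasurableSet.inter (measurableSet_le ?_ ?_) <| .inter (measurableSet_le ?_ ?_) <|
      .inter (measurableSet_le ?_ ?_) <| .inter (measurableSet_le ?_ ?_) <|
      .inter (measurableSet_le ?_ ?_) (measurableSet_le ?_ ?_) <;> fun_prop
  have hmp := ((MeasurePreserving.id (volume : Measure ℝ)).prod
    (volume_preserving_finTwoArrow ℝ)).comp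
      (volume_preserving_piFinSuccAbove (fun _ : Fin 3 => ℝ) 0)
  have hnonneg (t : ℝ) : 0 ≤ truncPowDiff 1 t := by
    rw [truncPowDiff_one]
    exact le_max_right _ _
  have hz (x y : ℝ) (hx : x ∈ Set.Icc (0 : ℝ) 1) :
      volume (Prod.mk y ⁻¹' (Prod.mk x ⁻¹' Q)) = (Set.Icc (0 : ℝ) 1).indicator
        (fun y => ENNReal.ofReal (truncPowDiff 1 (a * x + -b * y))) y := by
    by_cases hy : y ∈ Set.Icc (0 : ℝ) 1
    · have : Prod.mk y ⁻¹' (Prod.mk x ⁻¹' Q) =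
          Set.Icc (max (a * x) (b * y)) (min (1 + a * x) (1 + b * y)) := by
        ext z
        simp [hQ, hx.1, hx.2, hy.1, hy.2]
      rw [this, Real.volume_Icc, Set.indicator_of_mem hy, truncPowDiff_one,
        ENNReal.ofReal_max, ENNReal.ofReal_zero, max_eq_left zero_le]
      congr 1
      grind
    · have : Prod.mk y ⁻¹' (Prod.mk x ⁻¹' Q) = ∅ := by
        ext z
        simp only [hQ, Set.mem_preimage, Set.mem_ofPred_eq, Set.mem_empty_iff_false, iff_false]
        exact fun h => hy ⟨h.2.2.1, h.2.2.2.1⟩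
      rw [this, measure_empty, Set.indicator_of_notMem hy]
  have hyz (x : ℝ) : volume (Prod.mk x ⁻¹' Q) = (Set.Icc (0 : ℝ) 1).indicator
      (fun x => ENNReal.ofReal (∫ y in (0 : ℝ)..1, truncPowDiff 1 (a * x + -b * y))) x := by
    by_cases hx : x ∈ Set.Icc (0 : ℝ) 1
    · rw [Measure.volume_eq_prod, Measure.prod_apply (measurable_prodMk_left hQm),
        Set.indicator_of_mem hx]
      simp only [hz x _ hx]
      exact lintegral_indicator_Icc_ofReal (by fun_prop) fun _ => hnonneg _
    · have : Prod.mk x ⁻¹' Q = ∅ := by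
        ext z
        simp only [hQ, Set.mem_preimage, Set.mem_ofPred_eq, Set.mem_empty_iff_false, iff_false]
        exact fun h => hx ⟨h.1, h.2.1⟩
      rw [this, measure_empty, Set.indicator_of_notMem hx]
  have hvol := hmp.measure_preimage hQm.nullMeasurableSet
  refine hvol.trans ?_
  rw [Measure.prod_apply hQm]
  refine (lintegral_congr hyz).trans (lintegral_indicator_Icc_ofReal ?_ fun x => ?_)
  · exact intervalIntegral.continuous_parametric_intervalIntegral_of_continuous'
      (by fun_prop) _ _
  · exact intervalIntegral.integral_nonneg zero_le_one fun _ _ => hnonneg _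

/-- for positive integers `a ≥ b`, the volume of
`P = {(x,y,z) : 0 ≤ x ≤ 1, 0 ≤ y ≤ 1, max(ax,by) ≤ z ≤ min(1+ax,1+by)}` equals
`(6b-1)/(6ab)` when `a > b` and `(3a-1)/(3a²)` when `a = b`.  (By Von Korff's theorem this
is the F-signature of the intersection algebra `B(a,b)` for `n = 1`.) -/
theorem volume_Fsignature_region_n_one (a b : ℕ) (ha : 0 < a) (hb : 0 < b) (hba : b ≤ a)
    (P : Set (Fin 3 → ℝ))
    (hP : P = {p | 0 ≤ p 0 ∧ p 0 ≤ 1 ∧ 0 ≤ p 1 ∧ p 1 ≤ 1 ∧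
      max ((a : ℝ) * p 0) ((b : ℝ) * p 1) ≤ p 2 ∧
      p 2 ≤ min (1 + (a : ℝ) * p 0) (1 + (b : ℝ) * p 1)}) :
    (b < a → volume P = ENNReal.ofReal ((6 * (b : ℝ) - 1) / (6 * (a : ℝ) * (b : ℝ)))) ∧
    (a = b → volume P = ENNReal.ofReal ((3 * (a : ℝ) - 1) / (3 * (a : ℝ) ^ 2))) := by
  have ha1 : (1 : ℝ) ≤ a := by exact_mod_cast ha
  have hb1 : (1 : ℝ) ≤ b := by exact_mod_cast hb
  have ha0 : (a : ℝ) ≠ 0 := by positivity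
  have hb0 : (b : ℝ) ≠ 0 := by positivity
  rw [hP, volume_region_eq_integral, integral_integral_truncPowDiff_one ha0 hb0,
    truncPowDiff_three_of_one_le ha1, truncPowDiff_three_of_le_neg_one (neg_le_neg hb1),
    truncPowDiff_three_zero]
  constructor
  · intro h
    have h1 : (b : ℝ) + 1 ≤ a := by exact_mod_cast h
    rw [truncPowDiff_three_of_one_le (by linarith)]
    congr 1
    ring
  · rintro rfl
    rw [sub_self, truncPowDiff_three_zero]
    congr 1
    field_simp
    ring
end

section
/- Let n ≥ 1 and let b_1 ≥ b_2 ≥ … ≥ b_n be positive integers. Then ∫₀^{1/b_1} Σ_{i=0}^{n} (−1)^i S_i(b_1,…,b_n) · u^{i+1}/(i+1) du = 2 · Σ_{i=1}^{n} (−1)^{i−1} S_{i−1}(b_2,…,b_n) / (i(i+1)(i+2) b_1^{i+1}). -/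
open Finset intervalIntegral

/-- `S_j(b_1,…,b_n)`: the elementary symmetric polynomial of degree `j` evaluated at all the
entries of `b : Fin n → ℕ`, as a real number. -/
noncomputable def esymmAll (n : ℕ) (b : Fin n → ℕ) (j : ℕ) : ℝ :=
  ((Finset.univ.val.map (fun i : Fin n => (b i : ℝ))).esymm j)

/-- `S_j(b_2,…,b_n)`: the elementary symmetric polynomial of degree `j` evaluated at the
tail entries `b_2,…,b_n` (indices `i ≠ 0` of `b : Fin n → ℕ`), as a real number. -/
noncomputable def esymmTail (n : ℕ) (b : Fin n → ℕ) (j : ℕ) : ℝ :=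
  (((Finset.univ.filter (fun i : Fin n => (i : ℕ) ≠ 0)).val.map
    (fun i => (b i : ℝ))).esymm j)

theorem Multiset.esymm_cons_succ {R : Type*} [CommSemiring R] (a : R) (s : Multiset R) (k : ℕ) :
    (a ::ₘ s).esymm (k + 1) = s.esymm (k + 1) + a * s.esymm k := by
  simp [Multiset.esymm, Multiset.powersetCard_cons, Multiset.sum_map_mul_left]

theorem esymmAll_zero (n : ℕ) (b : Fin n → ℕ) : esymmAll n b 0 = 1 := by
  simp [esymmAll, Multiset.esymm]

theorem esymmTail_zero (n : ℕ) (b : Fin n → ℕ) : esymmTail n b 0 = 1 := by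
  simp [esymmTail, Multiset.esymm]

theorem esymmAll_succ (n : ℕ) (hn : 1 ≤ n) (b : Fin n → ℕ) (k : ℕ) :
    esymmAll n b (k + 1) = esymmTail n b (k + 1) + (b ⟨0, hn⟩ : ℝ) * esymmTail n b k := by
  have h : (Finset.univ : Finset (Fin n)) =
      Finset.cons ⟨0, hn⟩ (Finset.univ.filter (fun i : Fin n => (i : ℕ) ≠ 0)) (by simp) := by
    ext i
    simp [Fin.ext_iff, em]
  rw [esymmAll, h, Finset.cons_val, Multiset.map_cons, Multiset.esymm_cons_succ]
  rfl

theorem esymmTail_self (n : ℕ) (hn : 1 ≤ n) (b : Fin n → ℕ) : esymmTail n b n = 0 := by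
  have hcard : (Finset.univ.filter (fun i : Fin n => (i : ℕ) ≠ 0)).card < n := by
    simpa using Finset.card_lt_univ_of_notMem
      (s := Finset.univ.filter (fun i : Fin n => (i : ℕ) ≠ 0)) (x := ⟨0, hn⟩) (by simp)
  rw [esymmTail, Multiset.esymm, Multiset.powersetCard_eq_empty _ (by rwa [Multiset.card_map])]
  simp

/-- for positive integers `b_1 ≥ b_2 ≥ … ≥ b_n` (here `b_j = b ⟨j-1⟩`),
`∫₀^{1/b_1} Σ_{i=0}^n (-1)^i S_i(b_1,…,b_n) u^{i+1}/(i+1) du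
  = 2 Σ_{i=1}^n (-1)^{i-1} S_{i-1}(b_2,…,b_n)/(i(i+1)(i+2) b_1^{i+1})`. -/
theorem integral_B_formula (n : ℕ) (hn : 1 ≤ n) (b : Fin n → ℕ)
    (hb : ∀ i, 0 < b i) (hmono : ∀ i j : Fin n, i ≤ j → b j ≤ b i) :
    (∫ u in (0:ℝ)..(1 / (b ⟨0, hn⟩ : ℝ)),
      ∑ i ∈ Finset.range (n + 1),
        (-1 : ℝ) ^ i * esymmAll n b i * u ^ (i + 1) / ((i : ℝ) + 1)) =
    2 * ∑ j ∈ Finset.range n, (-1 : ℝ) ^ j * esymmTail n b j /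
        (((j : ℝ) + 1) * ((j : ℝ) + 2) * ((j : ℝ) + 3) * (b ⟨0, hn⟩ : ℝ) ^ (j + 2)) := by
  have hB : (b ⟨0, hn⟩ : ℝ) ≠ 0 := by exact_mod_cast (hb _).ne'
  have hsucc := esymmAll_succ n hn b
  generalize (b ⟨0, hn⟩ : ℝ) = B at hB hsucc ⊢
  set f : ℕ → ℝ := fun i =>
    (-1 : ℝ) ^ i * esymmTail n b i / (((i : ℝ) + 1) * ((i : ℝ) + 2) * B ^ (i + 2)) with hf
  have hint : (∫ u in (0:ℝ)..(1 / B), ∑ i ∈ Finset.range (n + 1),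
        (-1 : ℝ) ^ i * esymmAll n b i * u ^ (i + 1) / ((i : ℝ) + 1)) =
      ∑ i ∈ Finset.range (n + 1),
        (-1 : ℝ) ^ i * esymmAll n b i / (((i : ℝ) + 1) * ((i : ℝ) + 2) * B ^ (i + 2)) := by
    rw [intervalIntegral.integral_finsetSum
      fun i _ => Continuous.intervalIntegrable (by fun_prop) _ _]
    refine Finset.sum_congr rfl fun i _ => ?_
    rw [intervalIntegral.integral_div, intervalIntegral.integral_const_mul, integral_pow]
    have h1 : (i : ℝ) + 1 ≠ 0 := by positivity
    have h2 : (i : ℝ) + 2 ≠ 0 := by positivity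
    have h3 : (i : ℝ) + 1 + 1 ≠ 0 := by positivity
    push_cast
    rw [zero_pow (by lia), one_div, inv_pow]
    field_simp
    ring
  have hsum : ∑ i ∈ Finset.range n, f (i + 1) + f 0 = ∑ i ∈ Finset.range n, f i := by
    rw [← Finset.sum_range_succ', Finset.sum_range_succ]
    simp [hf, esymmTail_self n hn b]
  have hzero : (-1 : ℝ) ^ 0 * esymmAll n b 0 /
      ((((0 : ℕ) : ℝ) + 1) * (((0 : ℕ) : ℝ) + 2) * B ^ (0 + 2)) = f 0 := by
    simp [hf, esymmAll_zero, esymmTail_zero]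
  rw [hint, Finset.sum_range_succ', hzero, Finset.mul_sum, ← sub_eq_zero]
  have hterm : ∀ i : ℕ, (-1 : ℝ) ^ (i + 1) * esymmAll n b (i + 1) /
      ((((i + 1 : ℕ) : ℝ) + 1) * (((i + 1 : ℕ) : ℝ) + 2) * B ^ (i + 1 + 2)) =
      f (i + 1) - f i + 2 * ((-1 : ℝ) ^ i * esymmTail n b i /
        (((i : ℝ) + 1) * ((i : ℝ) + 2) * ((i : ℝ) + 3) * B ^ (i + 2))) := by
    intro i
    have h1 : (i : ℝ) + 1 ≠ 0 := by positivity
    have h2 : (i : ℝ) + 2 ≠ 0 := by positivity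
    have h3 : (i : ℝ) + 3 ≠ 0 := by positivity
    have e1 : (i : ℝ) + 1 + 1 = i + 2 := by ring
    have e2 : (i : ℝ) + 1 + 2 = i + 3 := by ring
    simp only [hf, hsucc]
    push_cast
    rw [e1, e2]
    field_simp
    ring
  simp only [hterm, Finset.sum_add_distrib, Finset.sum_sub_distrib]
  linarith
end

section
/- Let n ≥ 1, let b_1 = b_2 = … = b_n = 1, and let k ≥ 2 be an integer. Let P = {(x, y, z_1,…,z_n) ∈ ℝ^{n+2} : 0 ≤ x ≤ 1, 0 ≤ y ≤ 1, and max(k x, y) ≤ z_i ≤ min(1 + k x, 1 + y) for all i}. Then the Lebesgue volume of P equals (1/k)·(Σ_{i=0}^{n} (−1)^i binom(n,i)/(i+1) + B), where B = 2 Σ_{i=1}^{n} (−1)^{i−1} binom(n−1, i−1)/(i(i+1)(i+2)). (By Von Korff's theorem this volume is the F-signature of the intersection algebra B(k·b, b) with b = (1,…,1).) -/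
open Finset MeasureTheory

theorem integral_one_sub_pow (m : ℕ) :
    ∫ t in (0 : ℝ)..1, (1 - t) ^ m = 1 / ((m : ℝ) + 1) := by
  rw [intervalIntegral.integral_comp_sub_left (fun t : ℝ => t ^ m) 1]
  simp [integral_pow]

theorem one_sub_pow_eq_sum (t : ℝ) (m : ℕ) :
    (1 - t) ^ m = ∑ i ∈ Finset.range (m + 1), (-1 : ℝ) ^ i * (m.choose i : ℝ) * t ^ i := by
  rw [show 1 - t = -t + 1 by ring, add_pow]
  refine Finset.sum_congr rfl fun i _ => ?_
  rw [neg_pow]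
  ring

theorem sum_alternating_choose_div_succ (n : ℕ) :
    ∑ i ∈ Finset.range (n + 1), (-1 : ℝ) ^ i * (n.choose i : ℝ) / ((i : ℝ) + 1) =
      1 / ((n : ℝ) + 1) := by
  rw [← integral_one_sub_pow]
  simp_rw [one_sub_pow_eq_sum]
  rw [intervalIntegral.integral_finsetSum
    fun i _ => Continuous.intervalIntegrable (by fun_prop) _ _]
  refine Finset.sum_congr rfl fun i _ => ?_
  rw [intervalIntegral.integral_const_mul, integral_pow]
  simp [div_eq_mul_inv]

theorem integral_pow_mul_one_sub_sq (j : ℕ) :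
    ∫ t in (0 : ℝ)..1, t ^ j * (1 - t) ^ 2 =
      2 / (((j : ℝ) + 1) * ((j : ℝ) + 2) * ((j : ℝ) + 3)) := by
  have h : ∀ t : ℝ, t ^ j * (1 - t) ^ 2 = t ^ j - 2 * t ^ (j + 1) + t ^ (j + 2) := fun t => by ring
  simp_rw [h]
  rw [intervalIntegral.integral_add (Continuous.intervalIntegrable (by fun_prop) _ _)
      (Continuous.intervalIntegrable (by fun_prop) _ _),
    intervalIntegral.integral_sub (Continuous.intervalIntegrable (by fun_prop) _ _)
      (Continuous.intervalIntegrable (by fun_prop) _ _),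
    intervalIntegral.integral_const_mul, integral_pow, integral_pow, integral_pow]
  push_cast
  have h1 : (j : ℝ) + 1 ≠ 0 := by positivity
  have h2 : (j : ℝ) + 2 ≠ 0 := by positivity
  have h3 : (j : ℝ) + 3 ≠ 0 := by positivity
  rw [show (j : ℝ) + 1 + 1 = j + 2 by ring, show (j : ℝ) + 2 + 1 = j + 3 by ring]
  simp only [one_pow, ne_eq, Nat.succ_ne_zero, not_false_eq_true, zero_pow, sub_zero]
  field_simp
  ring

theorem two_mul_sum_alternating_choose_div (m : ℕ) :
    2 * ∑ j ∈ Finset.range (m + 1), (-1 : ℝ) ^ j * (m.choose j : ℝ) /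
      (((j : ℝ) + 1) * ((j : ℝ) + 2) * ((j : ℝ) + 3)) = 1 / ((m : ℝ) + 3) := by
  have h := integral_one_sub_pow (m + 2)
  simp_rw [pow_add, one_sub_pow_eq_sum _ m, Finset.sum_mul] at h
  rw [intervalIntegral.integral_finsetSum
    fun i _ => Continuous.intervalIntegrable (by fun_prop) _ _] at h
  simp_rw [mul_assoc, intervalIntegral.integral_const_mul, integral_pow_mul_one_sub_sq] at h
  push_cast at h
  rw [show (m : ℝ) + 2 + 1 = m + 3 by ring] at h
  rw [← h, Finset.mul_sum]
  refine Finset.sum_congr rfl fun j _ => ?_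
  ring

theorem volume_eq_lintegral_insertNth {m : ℕ} (i : Fin (m + 1)) {S : Set (Fin (m + 1) → ℝ)}
    (hS : MeasurableSet S) :
    volume S = ∫⁻ t : ℝ, volume {q : Fin m → ℝ | i.insertNth t q ∈ S} := by
  have e := (volume_preserving_piFinSuccAbove (fun _ : Fin (m + 1) => ℝ) i).symm
  rw [← e.measure_preimage hS.nullMeasurableSet, Measure.volume_eq_prod,
    Measure.prod_apply (e.measurable hS)]
  rfl

theorem integral_affine_pow (n : ℕ) {c : ℝ} (hc : c ≠ 0) (d a b : ℝ) :
    ∫ x in a..b, (d + c * x) ^ n =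
      ((d + c * b) ^ (n + 1) - (d + c * a) ^ (n + 1)) / (c * ((n : ℝ) + 1)) := by
  rw [intervalIntegral.integral_comp_add_mul (fun t : ℝ => t ^ n) hc, integral_pow, smul_eq_mul]
  have : (n : ℝ) + 1 ≠ 0 := by positivity
  field_simp

theorem integral_tent_pow {n : ℕ} (hn : 1 ≤ n) {k y : ℝ} (hk : 2 ≤ k) (hy0 : 0 ≤ y)
    (hy1 : y ≤ 1) :
    ∫ x in (0 : ℝ)..1, (max (1 - |k * x - y|) 0) ^ n =
      (2 - (1 - y) ^ (n + 1)) / (k * ((n : ℝ) + 1)) := by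
  have hk0 : 0 < k := by linarith
  have hint : ∀ a b : ℝ, IntervalIntegrable (fun x => (max (1 - |k * x - y|) 0) ^ n) volume a b :=
    fun a b => Continuous.intervalIntegrable (by fun_prop) _ _
  have ha : 0 ≤ y / k := by positivity
  have hab : y / k ≤ (1 + y) / k := by gcongr; linarith
  have hb : (1 + y) / k ≤ 1 := by rw [div_le_one hk0]; linarith
  have h1 : ∫ x in (0 : ℝ)..y / k, (max (1 - |k * x - y|) 0) ^ n =
      ∫ x in (0 : ℝ)..y / k, ((1 - y) + k * x) ^ n := by
    refine intervalIntegral.integral_congr fun x hx => ?_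
    rw [Set.uIcc_of_le ha, Set.mem_Icc, le_div_iff₀ hk0] at hx
    have hkx : 0 ≤ k * x := mul_nonneg hk0.le hx.1
    rw [abs_of_nonpos (by linarith), max_eq_left (by linarith)]
    ring
  have h2 : ∫ x in y / k..(1 + y) / k, (max (1 - |k * x - y|) 0) ^ n =
      ∫ x in y / k..(1 + y) / k, ((1 + y) + (-k) * x) ^ n := by
    refine intervalIntegral.integral_congr fun x hx => ?_
    rw [Set.uIcc_of_le hab, Set.mem_Icc, le_div_iff₀ hk0, div_le_iff₀ hk0] at hx
    rw [abs_of_nonneg (by linarith), max_eq_left (by linarith)]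
    ring
  have h3 : ∫ x in (1 + y) / k..1, (max (1 - |k * x - y|) 0) ^ n =
      ∫ x in (1 + y) / k..1, (0 : ℝ) := by
    refine intervalIntegral.integral_congr fun x hx => ?_
    rw [Set.uIcc_of_le hb, Set.mem_Icc, div_le_iff₀ hk0] at hx
    rw [abs_of_nonneg (by linarith), max_eq_right (by linarith), zero_pow (by omega)]
  rw [← intervalIntegral.integral_add_adjacent_intervals (hint 0 ((1 + y) / k)) (hint _ 1),
    ← intervalIntegral.integral_add_adjacent_intervals (hint 0 (y / k)) (hint _ _), h1, h2, h3,
    integral_affine_pow n hk0.ne', integral_affine_pow n (neg_ne_zero.2 hk0.ne'),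
    intervalIntegral.integral_zero, neg_mul, neg_mul, mul_div_cancel₀ _ hk0.ne',
    mul_div_cancel₀ _ hk0.ne']
  have : (n : ℝ) + 1 ≠ 0 := by positivity
  rw [show 1 - y + y = 1 by ring, show 1 + y + -y = 1 by ring, add_neg_cancel, neg_mul, div_neg,
    mul_zero]
  simp only [one_pow, zero_pow (Nat.succ_ne_zero n)]
  ring

theorem setLIntegral_Icc_ofReal {f : ℝ → ℝ} (hf : Continuous f)
    (h0 : ∀ x ∈ Set.Icc (0 : ℝ) 1, 0 ≤ f x) :
    ∫⁻ x in Set.Icc (0 : ℝ) 1, ENNReal.ofReal (f x) =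
      ENNReal.ofReal (∫ x in (0 : ℝ)..1, f x) := by
  rw [intervalIntegral.integral_of_le zero_le_one, ← integral_Icc_eq_integral_Ioc,
    ofReal_integral_eq_lintegral_ofReal hf.continuousOn.integrableOn_Icc]
  exact (ae_restrict_iff' measurableSet_Icc).2 (.of_forall h0)

theorem min_sub_max_eq (u y : ℝ) : min (1 + u) (1 + y) - max u y = 1 - |u - y| := by
  rw [min_add_add_left, abs_sub_comm, ← max_sub_min_eq_abs]
  ring

/-- for `b_1 = … = b_n = 1` and an integer `k ≥ 2`, the volume of
`P = {(x,y,z_1,…,z_n) : 0 ≤ x,y ≤ 1, max(kx, y) ≤ zᵢ ≤ min(1 + kx, 1 + y)}` equals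
`(1/k)(Σ_{i=0}^n (-1)^i C(n,i)/(i+1) + B)` where
`B = 2 Σ_{i=1}^n (-1)^{i-1} C(n-1,i-1)/(i(i+1)(i+2))`; by Von Korff's theorem this is the
F-signature of the intersection algebra `B(k·b, b)` with `b = (1,…,1)`. -/
theorem volume_Fsignature_region_k_ones (n : ℕ) (hn : 1 ≤ n) (k : ℕ) (hk : 2 ≤ k)
    (P : Set (Fin (n + 2) → ℝ))
    (hP : P = {p | 0 ≤ p 0 ∧ p 0 ≤ 1 ∧ 0 ≤ p 1 ∧ p 1 ≤ 1 ∧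
      ∀ i : Fin n,
        max ((k : ℝ) * p 0) (p 1) ≤ p i.succ.succ ∧
        p i.succ.succ ≤ min (1 + (k : ℝ) * p 0) (1 + p 1)}) :
    volume P = ENNReal.ofReal ((1 / (k : ℝ)) *
      ((∑ i ∈ Finset.range (n + 1), (-1 : ℝ) ^ i * (n.choose i : ℝ) / ((i : ℝ) + 1)) +
        2 * ∑ j ∈ Finset.range n, (-1 : ℝ) ^ j * ((n - 1).choose j : ℝ) /
          (((j : ℝ) + 1) * ((j : ℝ) + 2) * ((j : ℝ) + 3)))) := by
  have hPm : MeasurableSet P := by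
    rw [hP]
    simp only [Set.ofPred_and, Set.ofPred_forall]
    refine IsClosed.measurableSet ?_
    refine (isClosed_le (by fun_prop) (by fun_prop)).inter <|
      (isClosed_le (by fun_prop) (by fun_prop)).inter <|
      (isClosed_le (by fun_prop) (by fun_prop)).inter <|
      (isClosed_le (by fun_prop) (by fun_prop)).inter <| isClosed_iInter fun i =>
      (isClosed_le (by fun_prop) (by fun_prop)).inter
      (isClosed_le (by fun_prop) (by fun_prop))
  have hk' : (2 : ℝ) ≤ k := by exact_mod_cast hk
  have hslice : ∀ y x : ℝ, {z : Fin n → ℝ |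
      (0 : Fin (n + 1)).insertNth (α := fun _ => ℝ) x z ∈
        {q : Fin (n + 1) → ℝ | (1 : Fin (n + 2)).insertNth (α := fun _ => ℝ) y q ∈ P}} =
      {z | (0 ≤ x ∧ x ≤ 1) ∧ (0 ≤ y ∧ y ≤ 1) ∧
        z ∈ Set.Icc (fun _ : Fin n => max ((k : ℝ) * x) y)
          (fun _ => min (1 + (k : ℝ) * x) (1 + y))} := by
    intro y x
    have e0 : ∀ q : Fin (n + 1) → ℝ,
        (1 : Fin (n + 2)).insertNth (α := fun _ => ℝ) y q 0 = q 0 := fun q =>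
      Fin.insertNth_apply_succAbove (α := fun _ => ℝ) 1 y q 0
    have e1 : ∀ q : Fin (n + 1) → ℝ,
        (1 : Fin (n + 2)).insertNth (α := fun _ => ℝ) y q 1 = y := fun q =>
      Fin.insertNth_apply_same (α := fun _ => ℝ) 1 y q
    have e2 : ∀ (q : Fin (n + 1) → ℝ) (i : Fin n),
        (1 : Fin (n + 2)).insertNth (α := fun _ => ℝ) y q i.succ.succ = q i.succ := fun q i =>
      Fin.insertNth_apply_succAbove (α := fun _ => ℝ) 1 y q i.succ
    ext z
    simp only [hP, Set.mem_ofPred_eq, e0, e1, e2, Set.mem_Icc, Pi.le_def, Fin.insertNth_zero',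
      Fin.cons_zero, Fin.cons_succ, forall_and]
    tauto
  have hvol : ∀ y x : ℝ, volume {z : Fin n → ℝ |
      (0 : Fin (n + 1)).insertNth (α := fun _ => ℝ) x z ∈
        {q : Fin (n + 1) → ℝ | (1 : Fin (n + 2)).insertNth (α := fun _ => ℝ) y q ∈ P}} =
      (Set.Icc (0 : ℝ) 1).indicator (fun y => (Set.Icc (0 : ℝ) 1).indicator
        (fun x => ENNReal.ofReal ((max (1 - |(k : ℝ) * x - y|) 0) ^ n)) x) y := by
    intro y x
    rw [hslice]
    by_cases hy : y ∈ Set.Icc (0 : ℝ) 1 <;> by_cases hx : x ∈ Set.Icc (0 : ℝ) 1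
    · simp only [Set.indicator_of_mem hy, Set.indicator_of_mem hx]
      simp only [Set.mem_Icc] at hx hy
      simp only [hx, hy, true_and, and_self, Set.ofPred_mem_eq]
      rw [Real.volume_Icc_pi, ENNReal.ofReal_pow (le_max_right _ _)]
      simp [min_sub_max_eq]
    all_goals
      simp only [Set.mem_Icc] at hx hy
      simp [hx, hy, Set.indicator]
  rw [volume_eq_lintegral_insertNth 1 hPm]
  have hinner : ∀ y : ℝ,
      volume {q : Fin (n + 1) → ℝ | (1 : Fin (n + 2)).insertNth (α := fun _ => ℝ) y q ∈ P} =
      (Set.Icc (0 : ℝ) 1).indicator (fun y =>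
        ENNReal.ofReal ((2 - (1 - y) ^ (n + 1)) / (k * ((n : ℝ) + 1)))) y := by
    intro y
    have hm : Measurable fun q : Fin (n + 1) → ℝ =>
        (1 : Fin (n + 2)).insertNth (α := fun _ => ℝ) y q :=
      (Continuous.finInsertNth 1 continuous_const continuous_id).measurable
    refine (volume_eq_lintegral_insertNth 0 (hm hPm)).trans ((lintegral_congr (hvol y)).trans ?_)
    by_cases hy : y ∈ Set.Icc (0 : ℝ) 1
    · simp only [Set.indicator_of_mem hy]
      rw [lintegral_indicator measurableSet_Icc,
        setLIntegral_Icc_ofReal (by fun_prop) fun x _ => by positivity,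
        integral_tent_pow hn hk' hy.1 hy.2]
    · simp [Set.indicator_of_notMem hy]
  rw [lintegral_congr hinner, lintegral_indicator measurableSet_Icc, setLIntegral_Icc_ofReal]
  · congr 1
    obtain ⟨m, rfl⟩ : ∃ m, n = m + 1 := ⟨n - 1, by omega⟩
    rw [sum_alternating_choose_div_succ, Nat.add_sub_cancel, two_mul_sum_alternating_choose_div,
      intervalIntegral.integral_div, intervalIntegral.integral_sub
        (Continuous.intervalIntegrable (by fun_prop) _ _)
        (Continuous.intervalIntegrable (by fun_prop) _ _), integral_one_sub_pow]
    have : (k : ℝ) ≠ 0 := by positivity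
    have h1 : (m : ℝ) + 3 ≠ 0 := by positivity
    have h2 : (m : ℝ) + 2 ≠ 0 := by positivity
    push_cast
    rw [show (m : ℝ) + 1 + 1 + 1 = m + 3 by ring, show (m : ℝ) + 1 + 1 = m + 2 by ring]
    simp only [intervalIntegral.integral_const, sub_zero, one_smul]
    field_simp
    ring
  · fun_prop
  · intro y hy
    have : (1 - y) ^ (n + 1) ≤ 1 := pow_le_one₀ (by linarith [hy.2]) (by linarith [hy.1])
    refine div_nonneg (by linarith) (by positivity)
end

section
/- Let k be a field and let m ≥ 1 and b ≥ 1 be integers. Let φ : k[x_0, x_1,…,x_{m+2}] → k[x, u, v] be the k-algebra homomorphism determined by φ(x_0) = x, φ(x_1) = x^{mb}u, φ(x_2) = x^{b}v, and φ(x_{j+2}) = x^{mb}u v^{j} for j = 1,…,m. Then the kernel of φ equals the ideal I_2(M) generated by the 2×2 minors of the 2×(m+1) matrix M whose first row is (x_0^b, x_1, x_3, x_4,…, x_{m+1}) and whose second row is (x_2, x_3, x_4,…, x_{m+2}). (Hence the intersection algebra B(mb, b) for n = 1 is isomorphic to k[x_0,…,x_{m+2}]/I_2(M).) -/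
open MvPolynomial

/-- The first row `(x_0^b, x_1, x_3, x_4, …, x_{m+1})` of the matrix `M`. -/
noncomputable def row1 (k : Type*) [CommRing k] (m b : ℕ) (j : Fin (m + 1)) :
    MvPolynomial (Fin (m + 3)) k :=
  if (j : ℕ) = 0 then (X 0) ^ b
  else if (j : ℕ) = 1 then X 1
  else X ⟨(j : ℕ) + 1, by have := j.isLt; omega⟩

/-- The second row `(x_2, x_3, x_4, …, x_{m+2})` of the matrix `M`. -/
noncomputable def row2 (k : Type*) [CommRing k] (m b : ℕ) (j : Fin (m + 1)) :
    MvPolynomial (Fin (m + 3)) k :=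
  X ⟨(j : ℕ) + 2, by have := j.isLt; omega⟩

section NormalForm

variable {A : Type*} [CommRing A] {x t : A} {y : ℕ → A} {m b : ℕ}

/-- A product of `d` of the elements `y 0, …, y m` whose indices add up to `s`, built greedily
with the largest possible index first. -/
def greedyProd (y : ℕ → A) (m : ℕ) : ℕ → ℕ → A
  | 0, _ => 1
  | d + 1, s => y (min s m) * greedyProd y m d (s - min s m)

theorem mul_eq_mul_of_add_eq_add
    (hy : ∀ i j, i < m → j < m → y i * y (j + 1) = y (i + 1) * y j) {p q p' q' : ℕ}
    (hp : p ≤ m) (hq : q ≤ m) (hp' : p' ≤ m) (hq' : q' ≤ m) (h : p + q = p' + q') :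
    y p * y q = y p' * y q' := by
  have shift : ∀ n p q, p + n ≤ m → q + n ≤ m → y p * y (q + n) = y (p + n) * y q := by
    intro n
    induction n with
    | zero => intro p q _ _; rfl
    | succ n ih =>
      intro p q hp hq
      rw [← add_assoc, hy p (q + n) (by omega) (by omega), ih (p + 1) q (by omega) (by omega)]
      congr 2
      omega
  rcases le_total p p' with hle | hle
  · obtain ⟨n, rfl⟩ := Nat.exists_eq_add_of_le hle
    obtain rfl : q = q' + n := by omega
    exact shift n p q' hp' hq
  · obtain ⟨n, rfl⟩ := Nat.exists_eq_add_of_le hle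
    obtain rfl : q' = q + n := by omega
    exact (shift n p' q hp hq').symm

theorem mul_greedyProd
    (hy : ∀ i j, i < m → j < m → y i * y (j + 1) = y (i + 1) * y j) {d s j : ℕ}
    (hs : s ≤ m * d) (hj : j ≤ m) :
    y j * greedyProd y m d s = greedyProd y m (d + 1) (s + j) := by
  induction d generalizing s j with
  | zero =>
    obtain rfl : s = 0 := by simpa using hs
    simp [greedyProd, hj]
  | succ d ih =>
    rw [mul_add, mul_one] at hs
    rw [greedyProd, greedyProd, ← mul_assoc,
      mul_eq_mul_of_add_eq_add hy hj (min_le_right s m) (min_le_right (s + j) m)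
        (q' := j + min s m - min (s + j) m) (by omega) (by omega),
      mul_assoc, ih (by omega) (by omega)]
    congr 2
    omega

theorem mul_greedyProd_of_lt
    (hy : ∀ i j, i < m → j < m → y i * y (j + 1) = y (i + 1) * y j)
    (ht : ∀ j, j < m → t * y j = x ^ b * y (j + 1)) {d s : ℕ} (hs : s < m * d) :
    t * greedyProd y m d s = x ^ b * greedyProd y m d (s + 1) := by
  induction d generalizing s with
  | zero => simp at hs
  | succ d ih =>
    rw [mul_add, mul_one] at hs
    rcases lt_or_ge s m with hsm | hsm
    · have h := mul_greedyProd hy (d := d) (s := 0) (j := s + 1) (Nat.zero_le _) hsm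
      rw [zero_add] at h
      rw [greedyProd, min_eq_left hsm.le, Nat.sub_self, ← mul_assoc, ht s hsm, mul_assoc, h]
    · rw [greedyProd, min_eq_right hsm, mul_left_comm, ih (by omega), mul_left_comm,
        mul_greedyProd hy (by omega) le_rfl]
      congr 2
      omega

theorem pow_mul_greedyProd
    (hy : ∀ i j, i < m → j < m → y i * y (j + 1) = y (i + 1) * y j)
    (ht : ∀ j, j < m → t * y j = x ^ b * y (j + 1)) {d s n : ℕ} (hs : s + n ≤ m * d) :
    t ^ n * greedyProd y m d s = x ^ (b * n) * greedyProd y m d (s + n) := by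
  induction n with
  | zero => simp
  | succ n ih =>
    rw [pow_succ', mul_assoc, ih (by omega), mul_left_comm,
      mul_greedyProd_of_lt hy ht (by omega), mul_add, mul_one, pow_add, mul_assoc, add_assoc]

/-- The normal form of the monomials in `x`, `t` and `y 0, …, y m` of tri-degree `(α, d, v)`, where
`x`, `t` and `y j` have tri-degree `(1, 0, 0)`, `(b, 0, 1)` and `(m * b, 1, j)`. -/
def normalForm (x t : A) (y : ℕ → A) (m b α d v : ℕ) : A :=
  x ^ (α - b * (v - m * d) - m * b * d) * t ^ (v - m * d) * greedyProd y m d (min v (m * d))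

theorem normalForm_eq
    (hy : ∀ i j, i < m → j < m → y i * y (j + 1) = y (i + 1) * y j)
    (ht : ∀ j, j < m → t * y j = x ^ b * y (j + 1)) {a c d s : ℕ} (hs : s ≤ m * d) :
    normalForm x t y m b (a + b * c + m * b * d) d (c + s) =
      x ^ a * t ^ c * greedyProd y m d s := by
  unfold normalForm
  obtain ⟨n, e, rfl, hn, he⟩ : ∃ n e, c = e + n ∧ min (c + s) (m * d) = s + n ∧
      c + s - m * d = e :=
    ⟨c - (c + s - m * d), c + s - m * d, by omega, by omega, rfl⟩
  have hα : a + b * (e + n) + m * b * d - b * e - m * b * d = a + b * n := by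
    rw [mul_add]; omega
  rw [hn, he, hα, pow_add t, ← mul_assoc, mul_assoc (x ^ a * t ^ e),
    pow_mul_greedyProd hy ht (by omega), pow_add]
  ring

end NormalForm

section Minors

variable {k : Type*} [CommRing k] {m b : ℕ}

/-- The variables `x_1, x_3, x_4, …, x_{m+2}`, numbered from `0` to `m`. -/
noncomputable def minorVar (k : Type*) [CommRing k] (m j : ℕ) : MvPolynomial (Fin (m + 3)) k :=
  if j = 0 then X 1 else if h : j + 2 < m + 3 then X ⟨j + 2, h⟩ else 0

theorem row1_succ {j : ℕ} (hj : j < m) : row1 k m b ⟨j + 1, by omega⟩ = minorVar k m j := by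
  rcases j with - | j
  · simp [row1, minorVar]
  · simp [row1, minorVar, show j + 1 < m + 1 by omega]

theorem row2_succ {j : ℕ} (hj : j < m) :
    row2 k m b ⟨j + 1, by omega⟩ = minorVar k m (j + 1) := by
  simp [row2, minorVar, show j + 1 < m + 1 by omega]

/-- The ideal generated by the `2×2` minors of the matrix with rows `row1` and `row2`. -/
noncomputable def minorIdeal (k : Type*) [CommRing k] (m b : ℕ) :
    Ideal (MvPolynomial (Fin (m + 3)) k) :=
  Ideal.span {p | ∃ j j' : Fin (m + 1),
    p = row1 k m b j * row2 k m b j' - row1 k m b j' * row2 k m b j}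

theorem mk_row1_mul_row2 (j j' : Fin (m + 1)) :
    Ideal.Quotient.mk (minorIdeal k m b) (row1 k m b j * row2 k m b j') =
      Ideal.Quotient.mk (minorIdeal k m b) (row1 k m b j' * row2 k m b j) :=
  Ideal.Quotient.eq.2 (Ideal.subset_span ⟨j, j', rfl⟩)

theorem mk_minorVar_mul (i j : ℕ) (hi : i < m) (hj : j < m) :
    Ideal.Quotient.mk (minorIdeal k m b) (minorVar k m i) *
        Ideal.Quotient.mk (minorIdeal k m b) (minorVar k m (j + 1)) =
      Ideal.Quotient.mk (minorIdeal k m b) (minorVar k m (i + 1)) *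
        Ideal.Quotient.mk (minorIdeal k m b) (minorVar k m j) := by
  have h := mk_row1_mul_row2 (k := k) (b := b) (m := m) ⟨i + 1, by omega⟩ ⟨j + 1, by omega⟩
  rw [row1_succ hi, row1_succ hj, row2_succ hi, row2_succ hj, map_mul, map_mul] at h
  rw [h, mul_comm]

theorem mk_X_two_mul_minorVar (j : ℕ) (hj : j < m) :
    Ideal.Quotient.mk (minorIdeal k m b) (X ⟨2, by omega⟩) *
        Ideal.Quotient.mk (minorIdeal k m b) (minorVar k m j) =
      Ideal.Quotient.mk (minorIdeal k m b) (X 0) ^ b *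
        Ideal.Quotient.mk (minorIdeal k m b) (minorVar k m (j + 1)) := by
  have h := mk_row1_mul_row2 (k := k) (b := b) (m := m) 0 ⟨j + 1, by omega⟩
  rw [row1_succ hj, row2_succ hj, map_mul, map_mul] at h
  simp only [row1, row2, Fin.val_zero, if_true, map_pow] at h
  rw [h, mul_comm]

/-- The monomials to which the algebra map onto the intersection algebra sends the variables. -/
noncomputable def generator (k : Type*) [CommRing k] (m b : ℕ) (i : Fin (m + 3)) :
    MvPolynomial (Fin 3) k :=
  if (i : ℕ) = 0 then X 0
  else if (i : ℕ) = 1 then (X 0) ^ (m * b) * X 1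
  else if (i : ℕ) = 2 then (X 0) ^ b * X 2
  else (X 0) ^ (m * b) * X 1 * (X 2) ^ ((i : ℕ) - 2)

theorem aeval_generator_minorVar {j : ℕ} (hj : j ≤ m) :
    aeval (generator k m b) (minorVar k m j) = (X 0) ^ (m * b) * X 1 * (X 2) ^ j := by
  rcases j with - | j
  · simp [minorVar, generator]
  · simp [minorVar, generator, show j < m by omega]

theorem eq_X_or_minorVar (i : Fin (m + 3)) :
    (X i : MvPolynomial (Fin (m + 3)) k) = X 0 ∨
      (X i : MvPolynomial (Fin (m + 3)) k) = X ⟨2, by omega⟩ ∨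
      ∃ j ≤ m, (X i : MvPolynomial (Fin (m + 3)) k) = minorVar k m j := by
  obtain ⟨i, hi⟩ := i
  match i, hi with
  | 0, _ => exact Or.inl rfl
  | 1, _ => exact Or.inr (Or.inr ⟨0, Nat.zero_le _, by simp [minorVar]⟩)
  | 2, _ => exact Or.inr (Or.inl rfl)
  | i + 3, hi =>
    exact Or.inr (Or.inr ⟨i + 1, by omega, by simp [minorVar, show i < m by omega]⟩)

theorem exists_monomial_eq (e : Fin (m + 3) →₀ ℕ) :
    ∃ a c d s, s ≤ m * d ∧
      Ideal.Quotient.mk (minorIdeal k m b) (monomial e (1 : k)) =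
        Ideal.Quotient.mk (minorIdeal k m b) (X 0) ^ a *
          Ideal.Quotient.mk (minorIdeal k m b) (X ⟨2, by omega⟩) ^ c *
          greedyProd (fun j => Ideal.Quotient.mk (minorIdeal k m b) (minorVar k m j)) m d s ∧
      aeval (generator k m b) (monomial e (1 : k)) =
        (X 0) ^ (a + b * c + m * b * d) * (X 1) ^ d * (X 2) ^ (c + s) := by
  generalize hp : monomial e (1 : k) = p
  have hmem : p ∈ Submonoid.closure (Set.range (X : Fin (m + 3) → MvPolynomial _ k)) := by
    rw [← hp, monomial_eq, C_1, one_mul]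
    exact Submonoid.prod_mem _ fun i _ =>
      Submonoid.pow_mem _ (Submonoid.subset_closure (Set.mem_range_self i)) _
  clear hp
  induction hmem using Submonoid.closure_induction_left with
  | one => exact ⟨0, 0, 0, 0, by simp [greedyProd]⟩
  | mul_left q hq p _ ih =>
    obtain ⟨i, rfl⟩ := hq
    obtain ⟨a, c, d, s, hs, h₁, h₂⟩ := ih
    simp only [map_mul, h₁, h₂]
    rcases eq_X_or_minorVar (k := k) i with hi | hi | ⟨j, hj, hi⟩
    · refine ⟨a + 1, c, d, s, hs, by rw [hi]; ring, ?_⟩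
      rw [hi, aeval_X, generator, if_pos (Fin.val_zero _)]
      ring
    · refine ⟨a, c + 1, d, s, hs, by rw [hi]; ring, ?_⟩
      rw [hi, aeval_X]
      simp only [generator, OfNat.ofNat_ne_zero, OfNat.ofNat_ne_one, if_true, if_false]
      ring
    · refine ⟨a, c, d + 1, s + j, by rw [mul_add]; omega, ?_, ?_⟩
      · rw [hi, ← mul_greedyProd mk_minorVar_mul hs hj]
        ring
      · rw [hi, aeval_generator_minorVar hj]
        ring

theorem ker_aeval_generator :
    RingHom.ker (aeval (generator k m b) :
      MvPolynomial (Fin (m + 3)) k →ₐ[k] MvPolynomial (Fin 3) k) = minorIdeal k m b := by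
  apply le_antisymm
  · let ψ : MvPolynomial (Fin 3) k →ₗ[k] MvPolynomial (Fin (m + 3)) k ⧸ minorIdeal k m b :=
      (basisMonomials (Fin 3) k).constr k fun e =>
        normalForm (Ideal.Quotient.mk (minorIdeal k m b) (X 0))
          (Ideal.Quotient.mk (minorIdeal k m b) (X ⟨2, by omega⟩))
          (fun j => Ideal.Quotient.mk (minorIdeal k m b) (minorVar k m j)) m b (e 0) (e 1) (e 2)
    have hψ : ψ ∘ₗ (aeval (generator k m b)).toLinearMap =
        (Ideal.Quotient.mkₐ k (minorIdeal k m b)).toLinearMap := by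
      refine (basisMonomials (Fin (m + 3)) k).ext fun e => ?_
      obtain ⟨a, c, d, s, hs, h₁, h₂⟩ := exists_monomial_eq (k := k) (b := b) e
      have hmon : (X 0 : MvPolynomial (Fin 3) k) ^ (a + b * c + m * b * d) * X 1 ^ d *
          X 2 ^ (c + s) = basisMonomials (Fin 3) k (Finsupp.single 0 (a + b * c + m * b * d) +
            Finsupp.single 1 d + Finsupp.single 2 (c + s)) := by
        simp [X_pow_eq_monomial, monomial_mul]
      simp only [coe_basisMonomials, LinearMap.comp_apply, AlgHom.toLinearMap_apply,
        Ideal.Quotient.mkₐ_eq_mk]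
      rw [h₁, h₂, hmon, Module.Basis.constr_basis]
      simpa using normalForm_eq mk_minorVar_mul mk_X_two_mul_minorVar hs
    intro p hp
    have h := LinearMap.congr_fun hψ p
    rw [RingHom.mem_ker] at hp
    rw [LinearMap.comp_apply, AlgHom.toLinearMap_apply, hp, map_zero] at h
    exact Ideal.Quotient.eq_zero_iff_mem.1 h.symm
  · refine Ideal.span_le.2 ?_
    rintro _ ⟨j, j', rfl⟩
    have hrow : ∀ j : Fin (m + 1), aeval (generator k m b) (row2 k m b j) =
        aeval (generator k m b) (row1 k m b j) * X 2 := by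
      intro j
      induction j using Fin.cases with
      | zero => simp [row1, row2, generator]
      | succ j =>
        obtain ⟨j, hj⟩ := j
        have h₁ := row1_succ (k := k) (b := b) hj
        have h₂ := row2_succ (k := k) (b := b) hj
        simp only [Fin.succ_mk]
        rw [h₁, h₂, aeval_generator_minorVar hj.le, aeval_generator_minorVar hj, pow_succ]
        ring
    simp only [SetLike.mem_coe, RingHom.mem_ker, map_sub, map_mul, hrow]
    ring

end Minors

/-- let `φ : k[x_0,…,x_{m+2}] → k[x,u,v]` be the `k`-algebra map with
`φ(x_0) = x`, `φ(x_1) = x^{mb} u`, `φ(x_2) = x^b v` and `φ(x_{j+2}) = x^{mb} u v^j` for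
`j = 1,…,m`.  Then `ker φ` is the ideal generated by the `2×2` minors of the `2×(m+1)`
matrix `M` with rows `(x_0^b, x_1, x_3, …, x_{m+1})` and `(x_2, x_3, …, x_{m+2})`.
(Here `X 0 = x`, `X 1 = u`, `X 2 = v` in the target.) -/
theorem ker_phi_eq_minors (k : Type*) [Field k] (m b : ℕ) (hm : 1 ≤ m) (hb : 1 ≤ b)
    (φ : MvPolynomial (Fin (m + 3)) k →ₐ[k] MvPolynomial (Fin 3) k)
    (hφ : φ = aeval (fun i : Fin (m + 3) =>
      if (i : ℕ) = 0 then X 0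
      else if (i : ℕ) = 1 then (X 0) ^ (m * b) * X 1
      else if (i : ℕ) = 2 then (X 0) ^ b * X 2
      else (X 0) ^ (m * b) * X 1 * (X 2) ^ ((i : ℕ) - 2))) :
    RingHom.ker (φ : MvPolynomial (Fin (m + 3)) k →+* MvPolynomial (Fin 3) k) =
      Ideal.span {p | ∃ j j' : Fin (m + 1),
        p = row1 k m b j * row2 k m b j' - row1 k m b j' * row2 k m b j} := by
  subst hφ
  exact ker_aeval_generator
end

section
/- Let m ≥ 1 and b ≥ 1 be integers. Then the additive monoid Q = {(r, s, t) ∈ ℕ³ : t ≥ max(mbr, bs)} is generated by the finite set {(0,0,1), (1,0,mb), (0,1,b)} ∪ {(1, j, mb) : j = 1,…,m}. (Equivalently, the Hilbert set of the intersection algebra B(mb, b) is {(1,0), (0,1), (1,1), (1,2),…, (1,m)}.) -/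
/-- for integers `m, b ≥ 1`, the additive monoid
`Q = {(r,s,t) ∈ ℕ³ : t ≥ max(mbr, bs)}` is generated by
`{(0,0,1), (1,0,mb), (0,1,b)} ∪ {(1,j,mb) : j = 1,…,m}`.  (Equivalently, the Hilbert set of
the intersection algebra `B(mb, b)` is `{(1,0),(0,1),(1,1),…,(1,m)}`.) -/
theorem Q_mb_b_generators (m b : ℕ) (hm : 1 ≤ m) (hb : 1 ≤ b) :
    (AddSubmonoid.closure
      (({(0, 0, 1), (1, 0, m * b), (0, 1, b)} : Set (ℕ × ℕ × ℕ)) ∪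
        {p | ∃ j : ℕ, 1 ≤ j ∧ j ≤ m ∧ p = (1, j, m * b)}) : Set (ℕ × ℕ × ℕ)) =
      {p : ℕ × ℕ × ℕ | max (m * b * p.1) (b * p.2.1) ≤ p.2.2} := by
  apply Set.Subset.antisymm
  · intro p hp
    induction hp using AddSubmonoid.closure_induction with
    | mem p hp =>
      rcases hp with (rfl | rfl | rfl) | ⟨j, -, hj, rfl⟩
      · simp
      · simp
      · simp
      · simpa [mul_comm m b] using Nat.mul_le_mul_left b hj
    | zero => simp
    | add p q _ _ hp hq =>
      simp only [Set.mem_ofPred_eq, max_le_iff, Prod.fst_add, Prod.snd_add, mul_add] at hp hq ⊢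
      exact ⟨add_le_add hp.1 hq.1, add_le_add hp.2 hq.2⟩
  · rintro ⟨r, s, t⟩ h
    simp only [Set.mem_ofPred_eq, max_le_iff] at h
    obtain ⟨hr, hs⟩ := h
    rw [SetLike.mem_coe]
    induction r generalizing s t with
    | zero =>
      obtain ⟨d, rfl⟩ := Nat.exists_eq_add_of_le hs
      have key : ((0, s, b * s + d) : ℕ × ℕ × ℕ) = s • (0, 1, b) + d • (0, 0, 1) := by
        simp [mul_comm]
      rw [key]
      exact add_mem (nsmul_mem (AddSubmonoid.subset_closure (by simp)) s)
        (nsmul_mem (AddSubmonoid.subset_closure (by simp)) d)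
    | succ r ih =>
      rw [mul_add, mul_one] at hr
      obtain ⟨u, rfl⟩ := Nat.exists_eq_add_of_le ((Nat.le_add_left _ _).trans hr)
      have hu : m * b * r ≤ u := by omega
      rcases le_total s m with hsm | hsm
      · have key : ((r + 1, s, m * b + u) : ℕ × ℕ × ℕ) = (1, s, m * b) + (r, 0, u) := by
          simp [add_comm]
        rw [key]
        refine add_mem (AddSubmonoid.subset_closure ?_) (ih 0 u hu (by simp))
        rcases Nat.eq_zero_or_pos s with rfl | hpos
        · simp
        · exact Or.inr ⟨s, hpos, hsm, rfl⟩
      · obtain ⟨v, rfl⟩ := Nat.exists_eq_add_of_le hsm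
        have key : ((r + 1, m + v, m * b + u) : ℕ × ℕ × ℕ) = (1, m, m * b) + (r, v, u) := by
          simp [add_comm]
        rw [key]
        refine add_mem (AddSubmonoid.subset_closure (Or.inr ⟨m, hm, le_rfl, rfl⟩)) (ih v u hu ?_)
        rw [mul_add, mul_comm b m] at hs
        exact Nat.add_le_add_iff_left.mp hs
end

section
/- Let m ≥ 1 and b ≥ 1 be integers. Let C = {(x, y, z) ∈ ℝ³ : x ≥ 0, y ≥ 0, z ≥ max(mbx, by)} and let G = {(0,0,1), (1,0,mb), (0,1,b)} ∪ {(1, j, mb) : j = 1,…,m}. Let P = {p ∈ C : p ∉ g + C for every g ∈ G}. Then the Lebesgue volume of the closure of P equals ((m+1) − 6mb + 3m(m+3)b²)/(6mb²). (By Watanabe and Eto's theorem, this is the Hilbert-Kunz multiplicity of the intersection algebra B(mb, b) at its homogeneous maximal ideal: e_HK(B(mb,b)) = (a + b − 6ab + 3a²b + 9ab²)/(6ab²) with a = mb.) -/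
open MeasureTheory

/-- The integral over an interval of a power of the positive part. -/
lemma integral_max_zero_pow (n : ℕ) (hn : n ≠ 0) (a c : ℝ) :
    ∫ u in a..c, max 0 u ^ n = (max 0 c ^ (n + 1) - max 0 a ^ (n + 1)) / (n + 1) := by
  have hn1 : (n : ℝ) + 1 ≠ 0 := by positivity
  rw [integral_eq_of_hasDerivAt_off_countable
    (fun u : ℝ => max 0 u ^ (n + 1) / (n + 1)) _ (Set.countable_singleton (0 : ℝ))]
  · ring
  · fun_prop
  · rintro x ⟨-, hx⟩
    rcases lt_or_gt_of_ne (show x ≠ 0 from hx) with h | h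
    · have hd : HasDerivAt (fun _ : ℝ => (0 : ℝ)) (max 0 x ^ n) x := by
        rw [max_eq_left h.le, zero_pow hn]
        exact hasDerivAt_const x 0
      refine hd.congr_of_eventuallyEq ?_
      filter_upwards [Iio_mem_nhds h] with u hu
      simp [max_eq_left (le_of_lt (show u < 0 from hu))]
    · have hd : HasDerivAt (fun u : ℝ => u ^ (n + 1) / (n + 1)) (max 0 x ^ n) x := by
        rw [max_eq_right h.le]
        have := (hasDerivAt_pow (n + 1) x).div_const ((n : ℝ) + 1)
        rwa [Nat.cast_succ, add_tsub_cancel_right, mul_div_cancel_left₀ _ hn1] at this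
      refine hd.congr_of_eventuallyEq ?_
      filter_upwards [Ioi_mem_nhds h] with u hu
      simp [max_eq_right (le_of_lt (show 0 < u from hu))]
  · exact (by fun_prop : Continuous fun u : ℝ => max 0 u ^ n).intervalIntegrable _ _

/-- The primitive of `w ↦ min 1 (β * w)` that vanishes at `0`. -/
noncomputable def rampPrimitive (β t : ℝ) : ℝ := β / 2 * (t ^ 2 - max 0 (t - 1 / β) ^ 2)

lemma continuous_rampPrimitive (β : ℝ) : Continuous (rampPrimitive β) := by
  unfold rampPrimitive
  fun_prop

lemma rampPrimitive_nonneg {β t : ℝ} (hβ : 0 < β) (ht : 0 ≤ t) : 0 ≤ rampPrimitive β t := by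
  have h : 0 < 1 / β := by positivity
  refine mul_nonneg (by positivity) (sub_nonneg.2 ?_)
  exact pow_le_pow_left₀ (le_max_left _ _) (max_le ht (by linarith)) 2

lemma integral_min_one_mul {β : ℝ} (hβ : 0 < β) (t : ℝ) :
    ∫ w in (0 : ℝ)..t, min 1 (β * w) = rampPrimitive β t := by
  have h (w : ℝ) : min 1 (β * w) = β * w - β * max 0 (w - 1 / β) ^ 1 := by
    have h1 : β * (1 / β) = 1 := by field_simp
    rcases le_total w (1 / β) with hw | hw
    · rw [max_eq_left (by linarith), min_eq_right (by nlinarith)]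
      ring
    · rw [max_eq_right (by linarith), min_eq_left (by nlinarith)]
      linear_combination (-1 : ℝ) * h1
  have h0 : max 0 (0 - 1 / β) = 0 := max_eq_left (by simpa using hβ.le)
  simp_rw [h]
  rw [intervalIntegral.integral_sub (Continuous.intervalIntegrable (by fun_prop) _ _)
      (Continuous.intervalIntegrable (by fun_prop) _ _),
    intervalIntegral.integral_const_mul, intervalIntegral.integral_const_mul,
    intervalIntegral.integral_comp_sub_right (fun u => max 0 u ^ 1),
    integral_max_zero_pow 1 one_ne_zero, h0, integral_id, rampPrimitive]
  push_cast
  ring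

lemma integral_rampPrimitive {β : ℝ} (hβ : 0 < β) (t : ℝ) (ht : 1 / β ≤ t) :
    ∫ w in (0 : ℝ)..t, rampPrimitive β w = t ^ 2 / 2 - t / (2 * β) + 1 / (6 * β ^ 2) := by
  have h0 : max 0 (0 - 1 / β) = 0 := max_eq_left (by simpa using hβ.le)
  simp_rw [rampPrimitive]
  rw [intervalIntegral.integral_const_mul,
    intervalIntegral.integral_sub (Continuous.intervalIntegrable (by fun_prop) _ _)
      (Continuous.intervalIntegrable (by fun_prop) _ _),
    intervalIntegral.integral_comp_sub_right (fun u => max 0 u ^ 2),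
    integral_max_zero_pow 2 two_ne_zero, h0, integral_pow, max_eq_right (by linarith)]
  push_cast
  field_simp
  ring

lemma lintegral_Ici_min_one_mul {β c d : ℝ} (hβ : 0 < β) (hcd : c ≤ d) :
    ∫⁻ y in Set.Ici c, ENNReal.ofReal (min 1 (β * (d - y))) =
      ENNReal.ofReal (rampPrimitive β (d - c)) := by
  have hs : ∫⁻ y in Set.Ici c, ENNReal.ofReal (min 1 (β * (d - y))) =
      ∫⁻ y in Set.Icc c d, ENNReal.ofReal (min 1 (β * (d - y))) := by
    rw [← lintegral_indicator measurableSet_Ici, ← lintegral_indicator measurableSet_Icc]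
    refine lintegral_congr fun y => ?_
    by_cases hy : y ≤ d
    · simp [Set.indicator, hy]
    · have h0 : ENNReal.ofReal (min 1 (β * (d - y))) = 0 :=
        ENNReal.ofReal_of_nonpos ((min_le_right _ _).trans (by nlinarith))
      simp [Set.indicator, hy, h0]
  have hc : Continuous fun y : ℝ => min 1 (β * (d - y)) := by fun_prop
  rw [hs, ← ofReal_integral_eq_lintegral_ofReal hc.continuousOn.integrableOn_Icc,
    integral_Icc_eq_integral_Ioc, ← intervalIntegral.integral_of_le hcd,
    intervalIntegral.integral_comp_sub_left (fun w => min 1 (β * w)), sub_self,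
    integral_min_one_mul hβ]
  filter_upwards [ae_restrict_mem measurableSet_Icc] with y hy
  exact le_min zero_le_one (mul_nonneg hβ.le (by linarith [hy.2]))

/-- Fubini for a subset of `ℝ³` lying over a rectangle of the first two coordinates. -/
lemma volume_eq_lintegral_lintegral_fiber {S : Set (ℝ × ℝ × ℝ)} (hS : MeasurableSet S)
    {A B : Set ℝ} (hA : MeasurableSet A) (hB : MeasurableSet B) {H : ℝ → ℝ → ENNReal}
    (hSA : ∀ p ∈ S, p.1 ∈ A) (hSB : ∀ p ∈ S, p.2.1 ∈ B)
    (hH : ∀ x ∈ A, ∀ y ∈ B, volume {z | (x, y, z) ∈ S} = H x y) :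
    volume S = ∫⁻ x in A, ∫⁻ y in B, H x y := by
  rw [Measure.volume_eq_prod, Measure.prod_apply hS, ← lintegral_indicator hA]
  refine lintegral_congr fun x => ?_
  by_cases hx : x ∈ A
  · rw [Set.indicator_of_mem hx, Measure.volume_eq_prod,
      Measure.prod_apply (measurable_prodMk_left hS), ← lintegral_indicator hB]
    refine lintegral_congr fun y => ?_
    by_cases hy : y ∈ B
    · rw [Set.indicator_of_mem hy, ← hH x hx y hy]
      rfl
    · rw [Set.indicator_of_notMem hy]
      convert measure_empty (μ := (volume : Measure ℝ))
      ext z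
      simpa using fun h => hy (hSB _ h)
  · rw [Set.indicator_of_notMem hx]
    convert measure_empty (μ := (volume : Measure (ℝ × ℝ)))
    ext z
    simpa using fun h => hx (hSA _ h)

/-- Removing finitely many convex sets from a convex set leaves a set that has the same volume as
its closure. -/
lemma measure_closure_diff_biUnion_convex {E ι : Type*} [NormedAddCommGroup E] [NormedSpace ℝ E]
    [MeasurableSpace E] [BorelSpace E] [FiniteDimensional ℝ E] (μ : Measure E) [μ.IsAddHaarMeasure]
    {K : Set E} (hK : Convex ℝ K) {I : Set ι} (hI : I.Finite) {L : ι → Set E}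
    (hL : ∀ i ∈ I, Convex ℝ (L i)) :
    μ (closure (K \ ⋃ i ∈ I, L i)) = μ (K \ ⋃ i ∈ I, L i) := by
  have hU : μ (frontier (⋃ i ∈ I, L i)) = 0 := by
    induction I, hI using Set.Finite.induction_on with
    | empty => simp
    | @insert a s _ _ ih =>
      rw [Set.biUnion_insert]
      refine measure_mono_null (frontier_union_subset _ _) (measure_union_null ?_ ?_)
      · exact measure_mono_null Set.inter_subset_left ((hL a (by simp)).addHaar_frontier μ)
      · exact measure_mono_null Set.inter_subset_right
          (ih fun i hi => hL i (Set.mem_insert_of_mem _ hi))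
  have hF : μ (frontier (K \ ⋃ i ∈ I, L i)) = 0 := by
    rw [Set.sdiff_eq]
    refine measure_mono_null (frontier_inter_subset _ _) (measure_union_null ?_ ?_)
    · exact measure_mono_null Set.inter_subset_left (hK.addHaar_frontier μ)
    · exact measure_mono_null Set.inter_subset_right (by rwa [frontier_compl])
  rw [closure_eq_self_union_frontier]
  exact measure_congr (union_ae_eq_left_of_ae_eq_empty (ae_eq_empty.2 hF))

lemma rampPrimitive_mul_div {α β : ℝ} (hα : 0 < α) (t : ℝ) :
    rampPrimitive (α * β) (t / α) = rampPrimitive β t / α := by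
  have h : max 0 (t / α - 1 / (α * β)) = max 0 (t - 1 / β) / α := by
    rw [← max_div_div_right hα.le, zero_div, sub_div, div_div, mul_comm α β]
  rw [rampPrimitive, rampPrimitive, h]
  field_simp

lemma setLIntegral_Ico_ofReal {f : ℝ → ℝ} (hf : Continuous f) {a c : ℝ} (hac : a ≤ c)
    (h0 : ∀ x ∈ Set.Ico a c, 0 ≤ f x) :
    ∫⁻ x in Set.Ico a c, ENNReal.ofReal (f x) = ENNReal.ofReal (∫ x in a..c, f x) := by
  rw [intervalIntegral.integral_of_le hac, ← integral_Ico_eq_integral_Ioc,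
    ofReal_integral_eq_lintegral_ofReal
      (hf.continuousOn.integrableOn_Icc.mono_set Set.Ico_subset_Icc_self)]
  filter_upwards [ae_restrict_mem measurableSet_Ico] with x hx using h0 x hx

/-- The part of the cone `C` cut out by `x, y ≥ 0` and `z ≥ max (m * b * x) (b * y)` that lies in
none of the translates of `C` by `(0, 0, 1)`, `(0, 1, b)` and `(1, j, m * b)` with `0 ≤ j ≤ m`,
described by explicit inequalities. -/
def hkRegion (m b : ℕ) : Set (ℝ × ℝ × ℝ) :=
  {p | (0 ≤ p.1 ∧ 0 ≤ p.2.1 ∧ (m : ℝ) * b * p.1 ≤ p.2.2 ∧ (b : ℝ) * p.2.1 ≤ p.2.2) ∧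
    ((m : ℝ) * b * p.1 ≤ p.2.2 - 1 → p.2.2 - 1 < (b : ℝ) * p.2.1) ∧
    (1 ≤ p.2.1 → (m : ℝ) * b * p.1 ≤ p.2.2 - b → p.2.2 < (b : ℝ) * p.2.1) ∧
    ∀ j : ℕ, j ≤ m → 1 ≤ p.1 → (j : ℝ) ≤ p.2.1 → p.2.2 < (b : ℝ) * (m + p.2.1 - j)}

lemma mem_hkRegion {m b : ℕ} {x y z : ℝ} : (x, y, z) ∈ hkRegion m b ↔
    (0 ≤ x ∧ 0 ≤ y ∧ (m : ℝ) * b * x ≤ z ∧ (b : ℝ) * y ≤ z) ∧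
    ((m : ℝ) * b * x ≤ z - 1 → z - 1 < (b : ℝ) * y) ∧
    (1 ≤ y → (m : ℝ) * b * x ≤ z - b → z < (b : ℝ) * y) ∧
    ∀ j : ℕ, j ≤ m → 1 ≤ x → (j : ℝ) ≤ y → z < (b : ℝ) * (m + y - j) :=
  Iff.rfl

lemma measurableSet_hkRegion (m b : ℕ) : MeasurableSet (hkRegion m b) := by
  unfold hkRegion
  measurability

lemma measurableSet_hkRegion_inter_strip (m b j : ℕ) :
    MeasurableSet (hkRegion m b ∩ {p | 1 ≤ p.1 ∧ (j : ℝ) ≤ p.2.1 ∧ p.2.1 < j + 1}) :=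
  (measurableSet_hkRegion m b).inter (by measurability)

lemma volume_hkRegion_inter_lt_lt (m b : ℕ) :
    volume (hkRegion m b ∩ {p | p.1 < 1 ∧ p.2.1 < 1}) = 1 := by
  have hS : MeasurableSet (hkRegion m b ∩ {p | p.1 < 1 ∧ p.2.1 < 1}) :=
    (measurableSet_hkRegion m b).inter (by measurability)
  rw [volume_eq_lintegral_lintegral_fiber hS (A := Set.Ico 0 1) (B := Set.Ico 0 1)
    (H := fun _ _ => 1) measurableSet_Ico measurableSet_Ico]
  · simp
  · rintro ⟨x, y, z⟩ ⟨hp, hx, hy⟩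
    exact ⟨hp.1.1, hx⟩
  · rintro ⟨x, y, z⟩ ⟨hp, hx, hy⟩
    exact ⟨hp.1.2.1, hy⟩
  · rintro x ⟨hx0, hx1⟩ y ⟨hy0, hy1⟩
    have : {z | (x, y, z) ∈ hkRegion m b ∩ {p : ℝ × ℝ × ℝ | p.1 < 1 ∧ p.2.1 < 1}} =
        Set.Ico (max ((m : ℝ) * b * x) (b * y)) (max ((m : ℝ) * b * x) (b * y) + 1) := by
      ext z
      simp only [Set.mem_ofPred_eq, Set.mem_inter_iff, mem_hkRegion, Set.mem_Ico, max_le_iff,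
        ← sub_lt_iff_lt_add, lt_max_iff]
      constructor
      · rintro ⟨⟨⟨-, -, h1, h2⟩, h3, -⟩, -⟩
        refine ⟨⟨h1, h2⟩, ?_⟩
        by_contra! h
        linarith [h3 h.1, h.2]
      · rintro ⟨⟨h1, h2⟩, h3⟩
        refine ⟨⟨⟨hx0, hy0, h1, h2⟩, fun h => h3.resolve_left h.not_gt, fun h => ?_,
          fun _ _ h => ?_⟩, hx1, hy1⟩ <;> linarith
    rw [this, Real.volume_Ico]
    simp

lemma volume_hkRegion_inter_lt_le (m b : ℕ) (hm : 1 ≤ m) (hb : 1 ≤ b) :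
    volume (hkRegion m b ∩ {p | p.1 < 1 ∧ 1 ≤ p.2.1}) =
      ENNReal.ofReal ((m : ℝ) / 2 - 1 / (2 * b) + 1 / (6 * m * b ^ 2)) := by
  have hm1 : (1 : ℝ) ≤ m := by exact_mod_cast hm
  have hb1 : (1 : ℝ) ≤ b := by exact_mod_cast hb
  have hm0 : (0 : ℝ) < m := by linarith
  have hb0 : (0 : ℝ) < b := by linarith
  have hmb : (b : ℝ) ≤ m * b := by nlinarith
  have hS : MeasurableSet (hkRegion m b ∩ {p | p.1 < 1 ∧ 1 ≤ p.2.1}) :=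
    (measurableSet_hkRegion m b).inter (by measurability)
  rw [volume_eq_lintegral_lintegral_fiber hS (A := Set.Ico 0 1) (B := Set.Ici 1)
    (H := fun x y => ENNReal.ofReal (min 1 (b * (m * x + 1 - y))))
    measurableSet_Ico measurableSet_Ici]
  · have h1 : ∀ x ∈ Set.Ico (0 : ℝ) 1,
        ∫⁻ y in Set.Ici 1, ENNReal.ofReal (min 1 ((b : ℝ) * (m * x + 1 - y))) =
        ENNReal.ofReal (rampPrimitive b (m * x)) := by
      intro x hx
      have := mul_nonneg hm0.le hx.1
      rw [lintegral_Ici_min_one_mul hb0 (by linarith), add_sub_cancel_right]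
    rw [setLIntegral_congr_fun measurableSet_Ico h1, setLIntegral_Ico_ofReal
      (f := fun x => rampPrimitive b (m * x))
      ((continuous_rampPrimitive b).comp (by fun_prop)) zero_le_one
      fun x hx => rampPrimitive_nonneg hb0 (mul_nonneg hm0.le hx.1),
      intervalIntegral.integral_comp_mul_left _ hm0.ne', mul_zero, mul_one,
      integral_rampPrimitive hb0 _ (((div_le_one hb0).2 hb1).trans hm1), smul_eq_mul]
    congr 1
    field_simp
  · rintro ⟨x, y, z⟩ ⟨hp, hx, hy⟩
    exact ⟨hp.1.1, hx⟩
  · rintro ⟨x, y, z⟩ ⟨hp, hx, hy⟩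
    exact hy
  · rintro x ⟨hx0, hx1⟩ y hy1
    rw [Set.mem_Ici] at hy1
    have : {z | (x, y, z) ∈ hkRegion m b ∩ {p : ℝ × ℝ × ℝ | p.1 < 1 ∧ 1 ≤ p.2.1}} =
        Set.Ico (max ((m : ℝ) * b * x) (b * y))
          (min (max ((m : ℝ) * b * x) (b * y) + 1) (m * b * x + b)) := by
      ext z
      simp only [Set.mem_ofPred_eq, Set.mem_inter_iff, mem_hkRegion, Set.mem_Ico, max_le_iff,
        lt_min_iff, ← sub_lt_iff_lt_add, lt_max_iff]
      constructor
      · rintro ⟨⟨⟨-, -, h1, h2⟩, h3, h4, -⟩, -⟩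
        refine ⟨⟨h1, h2⟩, ?_, ?_⟩
        · by_contra! h
          linarith [h3 h.1, h.2]
        · by_contra! h
          linarith [h4 hy1 h]
      · rintro ⟨⟨h1, h2⟩, h3, h4⟩
        refine ⟨⟨⟨hx0, by linarith, h1, h2⟩, fun h => h3.resolve_left h.not_gt, fun _ h => ?_,
          fun _ _ h => ?_⟩, hx1, hy1⟩ <;> linarith
    rw [this, Real.volume_Ico]
    congr 1
    rcases le_total ((m : ℝ) * b * x) (b * y) with h | h
    · rw [max_eq_right h, ← min_sub_sub_right, add_sub_cancel_left]
      congr 1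
      ring
    · rw [max_eq_left h, min_eq_left (by linarith), min_eq_left (by nlinarith)]
      ring

lemma volume_hkRegion_inter_le_strip (m b : ℕ) (hm : 1 ≤ m) (hb : 1 ≤ b) (j : ℕ) (hj : j < m) :
    volume (hkRegion m b ∩ {p | 1 ≤ p.1 ∧ (j : ℝ) ≤ p.2.1 ∧ p.2.1 < j + 1}) =
      ENNReal.ofReal ((1 / 2 - 1 / (2 * b) + 1 / (6 * b ^ 2)) / m) := by
  have hm1 : (1 : ℝ) ≤ m := by exact_mod_cast hm
  have hb1 : (1 : ℝ) ≤ b := by exact_mod_cast hb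
  have hm0 : (0 : ℝ) < m := by linarith
  have hb0 : (0 : ℝ) < b := by linarith
  have hjm : (j : ℝ) + 1 ≤ m := by exact_mod_cast hj
  rw [volume_eq_lintegral_lintegral_fiber (measurableSet_hkRegion_inter_strip m b j)
    (A := Set.Ici 1) (B := Set.Ico (j : ℝ) (j + 1))
    (H := fun x y => ENNReal.ofReal (min 1 (m * b * ((m + y - j) / m - x))))
    measurableSet_Ici measurableSet_Ico, lintegral_lintegral_swap]
  · have h1 : ∀ y ∈ Set.Ico (j : ℝ) (j + 1),
        ∫⁻ x in Set.Ici 1, ENNReal.ofReal (min 1 ((m : ℝ) * b * ((m + y - j) / m - x))) =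
        ENNReal.ofReal (rampPrimitive b (y - j) / m) := by
      intro y hy
      rw [lintegral_Ici_min_one_mul (by positivity) ((one_le_div hm0).2 (by linarith [hy.1])),
        ← rampPrimitive_mul_div hm0]
      congr 2
      field_simp
      ring
    rw [setLIntegral_congr_fun measurableSet_Ico h1, setLIntegral_Ico_ofReal
      (f := fun y => rampPrimitive b (y - j) / m)
      (((continuous_rampPrimitive b).comp (by fun_prop)).div_const _) (by linarith)
      fun y hy => div_nonneg (rampPrimitive_nonneg hb0 (by linarith [hy.1])) hm0.le,
      intervalIntegral.integral_div,
      intervalIntegral.integral_comp_sub_right (rampPrimitive b), sub_self, add_sub_cancel_left,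
      integral_rampPrimitive hb0 _ ((div_le_one hb0).2 hb1), one_pow]
  · refine Measurable.aemeasurable (ENNReal.measurable_ofReal.comp ?_)
    exact (by fun_prop : Continuous fun p : ℝ × ℝ =>
      min 1 ((m : ℝ) * b * ((m + p.2 - j) / m - p.1))).measurable
  · rintro ⟨x, y, z⟩ ⟨hp, hx, hy⟩
    exact hx
  · rintro ⟨x, y, z⟩ ⟨hp, hx, hy⟩
    exact hy
  · rintro x hx1 y ⟨hy0, hy1⟩
    rw [Set.mem_Ici] at hx1
    have : {z | (x, y, z) ∈ hkRegion m b ∩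
          {p : ℝ × ℝ × ℝ | 1 ≤ p.1 ∧ (j : ℝ) ≤ p.2.1 ∧ p.2.1 < j + 1}} =
        Set.Ico ((m : ℝ) * b * x) (min (m * b * x + 1) (b * (m + y - j))) := by
      ext z
      simp only [Set.mem_ofPred_eq, Set.mem_inter_iff, mem_hkRegion, Set.mem_Ico, lt_min_iff]
      have hyx : (b : ℝ) * y ≤ m * b * x := by
        have h1 := mul_le_mul_of_nonneg_left (hy1.le.trans hjm) hb0.le
        have h2 := mul_le_mul_of_nonneg_left hx1 (mul_pos hm0 hb0).le
        linarith
      constructor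
      · rintro ⟨⟨⟨-, -, h1, -⟩, h3, -, h5⟩, -⟩
        refine ⟨h1, ?_, h5 j hj.le hx1 hy0⟩
        by_contra! h
        linarith [h3 (by linarith)]
      · rintro ⟨h1, h2, h3⟩
        refine ⟨⟨⟨by linarith, by linarith [(Nat.cast_nonneg j : (0 : ℝ) ≤ j)], h1, by linarith⟩,
          fun h => ?_, fun _ h => ?_, fun i _ _ hi => h3.trans_le ?_⟩, hx1, hy0, hy1⟩
        · linarith
        · linarith
        · have hij : (i : ℝ) ≤ j := by
            exact_mod_cast Nat.lt_succ_iff.1 (by exact_mod_cast hi.trans_lt hy1)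
          exact mul_le_mul_of_nonneg_left (by linarith) hb0.le
    rw [this, Real.volume_Ico, ← min_sub_sub_right, add_sub_cancel_left]
    congr 2
    field_simp

lemma volume_hkRegion (m b : ℕ) (hm : 1 ≤ m) (hb : 1 ≤ b) :
    volume (hkRegion m b) =
      ENNReal.ofReal ((((m : ℝ) + 1) - 6 * m * b + 3 * m * (m + 3) * b ^ 2) /
        (6 * m * b ^ 2)) := by
  have hm1 : (1 : ℝ) ≤ m := by exact_mod_cast hm
  have hb1 : (1 : ℝ) ≤ b := by exact_mod_cast hb
  have hm0 : (0 : ℝ) < m := by linarith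
  have hb0 : (0 : ℝ) < b := by linarith
  have hU : hkRegion m b = hkRegion m b ∩ {p | p.1 < 1 ∧ p.2.1 < 1} ∪
      (hkRegion m b ∩ {p | p.1 < 1 ∧ 1 ≤ p.2.1} ∪
        ⋃ j ∈ Finset.range m, hkRegion m b ∩ {p | 1 ≤ p.1 ∧ (j : ℝ) ≤ p.2.1 ∧ p.2.1 < j + 1}) := by
    refine Set.Subset.antisymm ?_ (Set.union_subset Set.inter_subset_left (Set.union_subset
      Set.inter_subset_left (Set.iUnion₂_subset fun j _ => Set.inter_subset_left)))
    rintro ⟨x, y, z⟩ hp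
    rcases lt_or_ge x 1 with hx | hx
    · rcases lt_or_ge y 1 with hy | hy
      · exact Or.inl ⟨hp, hx, hy⟩
      · exact Or.inr (Or.inl ⟨hp, hx, hy⟩)
    · refine Or.inr (Or.inr (Set.mem_iUnion₂.2 ⟨⌊y⌋₊, Finset.mem_range.2 ?_,
        hp, hx, Nat.floor_le hp.1.2.1, Nat.lt_floor_add_one y⟩))
      rw [Nat.floor_lt hp.1.2.1]
      by_contra! h
      have h1 : z < b * (m + y - m) := hp.2.2.2 m le_rfl hx h
      have h2 : (b : ℝ) * y ≤ z := hp.1.2.2.2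
      rw [add_sub_cancel_left] at h1
      exact h1.not_ge h2
  have hmeas1 : MeasurableSet (hkRegion m b ∩ {p | p.1 < 1 ∧ 1 ≤ p.2.1}) :=
    (measurableSet_hkRegion m b).inter (by measurability)
  have hmeas3 := Finset.measurableSet_biUnion (Finset.range m) fun j _ =>
    measurableSet_hkRegion_inter_strip m b j
  have hdisj1 : Disjoint (hkRegion m b ∩ {p | p.1 < 1 ∧ 1 ≤ p.2.1})
      (⋃ j ∈ Finset.range m,
        hkRegion m b ∩ {p | 1 ≤ p.1 ∧ (j : ℝ) ≤ p.2.1 ∧ p.2.1 < j + 1}) := by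
    rw [Set.disjoint_iUnion₂_right]
    exact fun j _ => Set.disjoint_left.2 fun p hp hp' => hp.2.1.not_ge hp'.2.1
  have hdisj2 : Disjoint (hkRegion m b ∩ {p | p.1 < 1 ∧ p.2.1 < 1})
      (hkRegion m b ∩ {p | p.1 < 1 ∧ 1 ≤ p.2.1} ∪ ⋃ j ∈ Finset.range m,
        hkRegion m b ∩ {p | 1 ≤ p.1 ∧ (j : ℝ) ≤ p.2.1 ∧ p.2.1 < j + 1}) := by
    rw [Set.disjoint_union_right, Set.disjoint_iUnion₂_right]
    exact ⟨Set.disjoint_left.2 fun p hp hp' => hp.2.2.not_ge hp'.2.2,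
      fun j _ => Set.disjoint_left.2 fun p hp hp' => hp.2.1.not_ge hp'.2.1⟩
  have hdisj3 : (Finset.range m : Set ℕ).PairwiseDisjoint
      fun j : ℕ => hkRegion m b ∩ {p | 1 ≤ p.1 ∧ (j : ℝ) ≤ p.2.1 ∧ p.2.1 < j + 1} := by
    refine fun i _ j _ hij => Set.disjoint_left.2 fun p hp hp' => hij (le_antisymm ?_ ?_)
    · exact Nat.lt_succ_iff.1 (by exact_mod_cast hp.2.2.1.trans_lt hp'.2.2.2)
    · exact Nat.lt_succ_iff.1 (by exact_mod_cast hp'.2.2.1.trans_lt hp.2.2.2)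
  have hinv : 1 / (b : ℝ) ≤ 1 := (div_le_one hb0).2 hb1
  have hinv2 : 1 / (2 * (b : ℝ)) = 1 / b / 2 := by field_simp
  rw [hU, measure_union hdisj2 (hmeas1.union hmeas3), measure_union hdisj1 hmeas3,
    measure_biUnion_finset hdisj3 fun j _ =>
      measurableSet_hkRegion_inter_strip m b j, volume_hkRegion_inter_lt_lt m b,
    volume_hkRegion_inter_lt_le m b hm hb, Finset.sum_congr rfl fun j hj =>
      volume_hkRegion_inter_le_strip m b hm hb j (Finset.mem_range.1 hj), Finset.sum_const,
    Finset.card_range, ← ENNReal.ofReal_nsmul, ← ENNReal.ofReal_one, ← ENNReal.ofReal_add,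
    ← ENNReal.ofReal_add zero_le_one]
  · congr 1
    rw [nsmul_eq_mul]
    field_simp
    ring
  · have : 0 ≤ 1 / (6 * (m : ℝ) * b ^ 2) := by positivity
    have h2 : 0 ≤ (1 / 2 - 1 / (2 * (b : ℝ)) + 1 / (6 * b ^ 2)) / m := by
      have : 0 ≤ 1 / (6 * (b : ℝ) ^ 2) := by positivity
      exact div_nonneg (by linarith) hm0.le
    exact add_nonneg (by linarith) (nsmul_nonneg h2 m)
  · have : 0 ≤ 1 / (6 * (m : ℝ) * b ^ 2) := by positivity
    linarith
  · refine nsmul_nonneg (div_nonneg ?_ hm0.le) m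
    have : 0 ≤ 1 / (6 * (b : ℝ) ^ 2) := by positivity
    linarith

/-- for integers `m, b ≥ 1`, let
`C = {(x,y,z) ∈ ℝ³ : x ≥ 0, y ≥ 0, z ≥ max(mbx, by)}`,
`G = {(0,0,1), (1,0,mb), (0,1,b)} ∪ {(1,j,mb) : j = 1,…,m}` and
`P = {p ∈ C : p ∉ g + C for every g ∈ G}`.  Then the volume of the closure of `P` equals
`((m+1) - 6mb + 3m(m+3)b²)/(6mb²)`, the Hilbert–Kunz multiplicity of `B(mb, b)`. -/
theorem volume_HK_region (m b : ℕ) (hm : 1 ≤ m) (hb : 1 ≤ b)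
    (C : Set (ℝ × ℝ × ℝ))
    (hC : C = {p | 0 ≤ p.1 ∧ 0 ≤ p.2.1 ∧
      max ((m : ℝ) * (b : ℝ) * p.1) ((b : ℝ) * p.2.1) ≤ p.2.2})
    (G : Set (ℝ × ℝ × ℝ))
    (hG : G = ({((0 : ℝ), (0 : ℝ), (1 : ℝ)), (1, 0, (m : ℝ) * b), (0, 1, (b : ℝ))} :
        Set (ℝ × ℝ × ℝ)) ∪
      {p | ∃ j : ℕ, 1 ≤ j ∧ j ≤ m ∧ p = (1, (j : ℝ), (m : ℝ) * b)})
    (P : Set (ℝ × ℝ × ℝ))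
    (hP : P = {p ∈ C | ∀ g ∈ G, ¬ ∃ c ∈ C, p = g + c}) :
    volume (closure P) =
      ENNReal.ofReal ((((m : ℝ) + 1) - 6 * m * b + 3 * m * (m + 3) * b ^ 2) /
        (6 * m * b ^ 2)) := by
  have hCconv : Convex ℝ C := by
    rw [hC]
    rintro ⟨x, y, z⟩ ⟨hx, hy, hz⟩ ⟨x', y', z'⟩ ⟨hx', hy', hz'⟩ s t hs ht -
    rw [max_le_iff] at hz hz'
    simp only [] at hx hy hz hx' hy' hz'
    have h1 := mul_le_mul_of_nonneg_left hz.1 hs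
    have h2 := mul_le_mul_of_nonneg_left hz.2 hs
    have h3 := mul_le_mul_of_nonneg_left hz'.1 ht
    have h4 := mul_le_mul_of_nonneg_left hz'.2 ht
    refine ⟨?_, ?_, max_le ?_ ?_⟩ <;>
      simp only [Prod.smul_mk, Prod.mk_add_mk, smul_eq_mul]
    · positivity
    · positivity
    · linarith
    · linarith
  have hGfin : G.Finite := by
    rw [hG]
    refine Set.Finite.union (by simp) ((Set.finite_Icc 1 m).image
      (fun j : ℕ => ((1 : ℝ), (j : ℝ), (m : ℝ) * b)) |>.subset ?_)
    rintro p ⟨j, h1, h2, rfl⟩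
    exact ⟨j, ⟨h1, h2⟩, rfl⟩
  have hPdiff : P = C \ ⋃ g ∈ G, (fun c => g + c) '' C := by
    rw [hP]
    ext p
    simp only [Set.mem_ofPred_eq, Set.mem_sdiff, Set.mem_iUnion, Set.mem_image, eq_comm,
      not_exists]
  have : (volume : Measure (ℝ × ℝ)).IsAddHaarMeasure := by
    rw [Measure.volume_eq_prod]
    infer_instance
  have : (volume : Measure (ℝ × ℝ × ℝ)).IsAddHaarMeasure := by
    rw [Measure.volume_eq_prod]
    infer_instance
  have hPC : volume (closure P) = volume P := by
    rw [hPdiff]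
    exact measure_closure_diff_biUnion_convex volume hCconv hGfin
      fun g _ => hCconv.translate g
  have hmem (g p : ℝ × ℝ × ℝ) : (∃ c ∈ C, p = g + c) ↔ g.1 ≤ p.1 ∧ g.2.1 ≤ p.2.1 ∧
      (m : ℝ) * b * (p.1 - g.1) ≤ p.2.2 - g.2.2 ∧ (b : ℝ) * (p.2.1 - g.2.1) ≤ p.2.2 - g.2.2 := by
    have h : (∃ c ∈ C, p = g + c) ↔ p - g ∈ C :=
      ⟨by rintro ⟨c, hc, rfl⟩; simpa using hc, fun h => ⟨_, h, by simp⟩⟩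
    rw [h, hC]
    simp
  have hPregion : P = hkRegion m b := by
    ext ⟨x, y, z⟩
    rw [hP, mem_hkRegion]
    simp only [Set.mem_ofPred_eq, hmem]
    constructor
    · rintro ⟨hxyz, hg⟩
      rw [hC] at hxyz
      obtain ⟨hx, hy, hz⟩ := hxyz
      rw [max_le_iff] at hz
      refine ⟨⟨hx, hy, hz⟩, fun h1 => ?_, fun h1 h2 => ?_, fun j hj h1 h2 => ?_⟩ <;> by_contra! h
      · exact hg (0, 0, 1) (by simp [hG]) ⟨hx, hy, by simpa using h1, by simpa using h⟩
      · refine hg (0, 1, b) (by simp [hG]) ⟨hx, h1, by simpa using h2, ?_⟩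
        simp only
        linarith
      · refine hg (1, j, m * b) ?_ ⟨h1, h2, ?_, ?_⟩
        · rw [hG]
          rcases Nat.eq_zero_or_pos j with rfl | hj0
          · simp
          · exact Or.inr ⟨j, hj0, hj, rfl⟩
        · have := hz.1
          simp only at this ⊢
          linarith
        · simp only
          linarith
    · rintro ⟨⟨hx, hy, hz⟩, h1, h2, h3⟩
      have key (j : ℕ) (hj : j ≤ m) : ¬(1 ≤ x ∧ (j : ℝ) ≤ y ∧ (m : ℝ) * b * (x - 1) ≤ z - m * b ∧
          (b : ℝ) * (y - j) ≤ z - m * b) := by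
        rintro ⟨h4, h5, -, h6⟩
        linarith [h3 j hj h4 h5]
      refine ⟨by rw [hC]; exact ⟨hx, hy, max_le hz.1 hz.2⟩, fun g hg => ?_⟩
      rw [hG] at hg
      rcases hg with (rfl | rfl | rfl) | ⟨j, -, hj, rfl⟩
      · rintro ⟨-, -, h4, h5⟩
        simp only [sub_zero] at h4 h5
        linarith [h1 h4]
      · exact_mod_cast key 0 (Nat.zero_le m)
      · rintro ⟨-, h4, h5, h6⟩
        simp only [sub_zero] at h4 h5 h6
        linarith [h2 h4 h5]
      · exact key j hj
  rw [hPC, hPregion, volume_hkRegion m b hm hb]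
end
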